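/- arXiv:2111.14410 — 2 statements merged into one kernel-verified Lean document; each statement's English description precedes it below -/
import Mathlib

section
/- Let n ≥ 6 and let h ∈ ℂ[X₀,…,Xₙ] be an irreducible homogeneous polynomial of degree d defining a totally invariant hypersurface X = {h = 0} ⊂ ℙⁿ(ℂ) whose singular locus has dimension at most 1, i.e. the Jacobian ring J(h) has Krull dimension ≤ 2. Then d = 1, i.e. X is a hyperplane. -/
open MvPolynomial

/-- `F` is an endomorphism of `ℙ^{N-1}(ℂ)` of algebraic degree `q`: a tuple of `N`
homogeneous polynomials of degree `q` in `N` variables whose only common zero in `ℂ^N`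
is the origin. -/
def IsEndo (N q : ℕ) (F : Fin N → MvPolynomial (Fin N) ℂ) : Prop :=
  (∀ i, (F i).IsHomogeneous q) ∧
    ∀ x : Fin N → ℂ, (∀ i, eval x (F i) = 0) → x = 0

/-- The hypersurface `{h = 0} ⊂ ℙ^{N-1}(ℂ)` is totally invariant: there is a non-trivial
endomorphism `F` (of algebraic degree `q ≥ 2`) and `λ ≠ 0` with `h(F₀,…,F_{N-1}) = λ·h^q`. -/
def IsTotallyInvariant (N : ℕ) (h : MvPolynomial (Fin N) ℂ) : Prop :=
  ∃ q, 2 ≤ q ∧ ∃ F : Fin N → MvPolynomial (Fin N) ℂ, IsEndo N q F ∧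
    ∃ lam : ℂ, lam ≠ 0 ∧ aeval F h = C lam * h ^ q

/-- The Jacobian ideal `(h, ∂h/∂X₀, …, ∂h/∂X_{N-1})`. -/
noncomputable def jacobianIdeal (N : ℕ) (h : MvPolynomial (Fin N) ℂ) : Ideal (MvPolynomial (Fin N) ℂ) :=
  Ideal.span (insert h (Set.range fun i => pderiv i h))


/-- core algebra -/
lemma core_alg {S : Type*} [CommRing S] [IsDomain S] {m : Type*} [Fintype m] [DecidableEq m]
    (D : Matrix m m S) (α w : m → S) (H : S) (hH : H ≠ 0)
    (hD : D.mulVec α = fun k => H * w k)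
    (C1 : ∀ z, (∀ i, H ∣ z * α i) → H ∣ z)
    (C2 : ∀ β : m → S, (∀ i j, H ∣ α i * β j - α j * β i) → ∃ t, ∀ j, H ∣ β j - t * α j) :
    ∃ (t : m → S) (b : S), D.det = ∑ k, t k * (D.mulVec α) k + H ^ 2 * b := by
  have key : ∀ (E : Matrix m m S), (∀ k, H ∣ (E.mulVec α) k) → H ∣ E.det := by
    intro E hE
    apply C1
    intro i
    have h1 : (E.adjugate.mulVec (E.mulVec α)) i = E.det * α i := by
      rw [Matrix.mulVec_mulVec, Matrix.adjugate_mul, Matrix.smul_mulVec, Matrix.one_mulVec]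
      rfl
    rw [← h1, Matrix.mulVec, dotProduct]
    exact Finset.dvd_sum fun k _ => (hE k).mul_left _
  have hJ : H ∣ D.det := key D (fun k => by rw [hD]; exact dvd_mul_right _ _)
  obtain ⟨G, hG⟩ := hJ
  have hGα : ∀ j, G * α j = ∑ k, D.adjugate j k * w k := by
    intro j
    apply mul_left_cancel₀ hH
    have h1 : (D.adjugate.mulVec (D.mulVec α)) j = D.det * α j := by
      rw [Matrix.mulVec_mulVec, Matrix.adjugate_mul, Matrix.smul_mulVec, Matrix.one_mulVec]
      rfl
    rw [← mul_assoc, ← hG, ← h1, hD, Matrix.mulVec, dotProduct, Finset.mul_sum]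
    exact Finset.sum_congr rfl fun k _ => by ring
  have hcol : ∀ k, ∃ t, ∀ j, H ∣ D.adjugate j k - t * α j := by
    intro k
    apply C2 (fun j => D.adjugate j k)
    intro i j
    have h2 : α i * D.adjugate j k - α j * D.adjugate i k =
        (D.updateRow k (α i • Pi.single j 1 - α j • Pi.single i 1)).det := by
      rw [sub_eq_add_neg (α i • _), Matrix.det_updateRow_add, ← neg_smul,
        Matrix.det_updateRow_smul, Matrix.det_updateRow_smul,
        Matrix.adjugate_apply, Matrix.adjugate_apply]
      ring
    rw [h2]
    apply key
    intro l
    by_cases hl : l = k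
    · subst hl
      change H ∣ (D.updateRow l (α i • Pi.single j 1 - α j • Pi.single i 1) l) ⬝ᵥ α
      rw [Matrix.updateRow_self, sub_dotProduct, smul_dotProduct, smul_dotProduct,
        single_dotProduct, single_dotProduct]
      simp [mul_comm]
    · have : (Matrix.mulVec (D.updateRow k (α i • Pi.single j 1 - α j • Pi.single i 1)) α) l
          = (D.mulVec α) l := by
        simp [Matrix.mulVec, Matrix.updateRow_ne hl]
      rw [this, hD]; exact dvd_mul_right _ _
  choose t ht using hcol
  have hGt : H ∣ G - ∑ k, t k * w k := by
    apply C1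
    intro j
    have : (G - ∑ k, t k * w k) * α j = ∑ k, (D.adjugate j k - t k * α j) * w k := by
      rw [sub_mul, hGα, Finset.sum_mul, ← Finset.sum_sub_distrib]
      exact Finset.sum_congr rfl fun k _ => by ring
    rw [this]
    exact Finset.dvd_sum fun k _ => (ht k j).mul_right _
  obtain ⟨b, hb⟩ := hGt
  refine ⟨t, b, ?_⟩
  rw [hG, sub_eq_iff_eq_add.mp hb, hD, mul_add, Finset.mul_sum, add_comm]
  congr 1
  · exact Finset.sum_congr rfl fun k _ => by ring
  · ring

/-- Koszul cancellation from a regular sequence -/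
lemma koszul_cancel {S A : Type*} [CommRing S] [CommRing A] (ι : A →+* S)
    {m : Type*} [Fintype m] (α : m → S) (H : S) (u v : A)
    (hu : ι u ∈ Ideal.span (insert H (Set.range α))) (hv : ι v ∈ Ideal.span (insert H (Set.range α)))
    (R1 : ∀ z, H ∣ ι u * z → H ∣ z)
    (R2 : ∀ s s', H ∣ ι v * s - ι u * s' → ∃ t, H ∣ s - ι u * t) :
    (∀ z, (∀ i, H ∣ z * α i) → H ∣ z) ∧
    (∀ β : m → S, (∀ i j, H ∣ α i * β j - α j * β i) → ∃ t, ∀ j, H ∣ β j - t * α j) := by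
  have C1 : (∀ z, (∀ i, H ∣ z * α i) → H ∣ z) := by
    intro z hz
    apply R1
    have : ∀ x ∈ Ideal.span (insert H (Set.range α)), H ∣ x * z := by
      intro x hx
      induction hx using Submodule.span_induction with
      | mem x hx =>
        rcases hx with rfl | ⟨i, rfl⟩
        · exact dvd_mul_right _ _
        · rw [mul_comm]; exact hz i
      | zero => simp
      | add x y _ _ hx hy => rw [add_mul]; exact dvd_add hx hy
      | smul a x _ hx => rw [smul_eq_mul, mul_assoc]; exact hx.mul_left _
    exact this _ hu
  refine ⟨C1, ?_⟩
  intro β hβ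
  have ex : ∀ x ∈ Ideal.span (insert H (Set.range α)), ∃ s, ∀ j, H ∣ x * β j - s * α j := by
    intro x hx
    induction hx using Submodule.span_induction with
    | mem x hx =>
      rcases hx with rfl | ⟨i, rfl⟩
      · exact ⟨0, fun j => by simp⟩
      · exact ⟨β i, fun j => by simpa [mul_comm] using hβ i j⟩
    | zero => exact ⟨0, by simp⟩
    | add x y _ _ hx hy =>
      obtain ⟨s, hs⟩ := hx
      obtain ⟨s', hs'⟩ := hy
      refine ⟨s + s', fun j => ?_⟩
      convert dvd_add (hs j) (hs' j) using 1
      ring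
    | smul a x _ hx =>
      obtain ⟨s, hs⟩ := hx
      refine ⟨a * s, fun j => ?_⟩
      convert (hs j).mul_left a using 1
      simp; ring
  obtain ⟨s, hs⟩ := ex _ hu
  obtain ⟨s', hs'⟩ := ex _ hv
  have h1 : H ∣ ι v * s - ι u * s' := by
    apply C1
    intro j
    convert dvd_sub ((hs' j).mul_left (ι u)) ((hs j).mul_left (ι v)) using 1
    ring
  obtain ⟨t, ht⟩ := R2 _ _ h1
  refine ⟨t, fun j => R1 _ ?_⟩
  convert dvd_add (hs j) (ht.mul_right (α j)) using 1
  ring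

/-- regularity -/
lemma reg_of_monic {S A : Type*} [CommRing S] [CommRing A] [IsDomain A]
    [DecompositionMonoid A] (e : S ≃+* Polynomial A) (H : S) (p : Polynomial A) (hp : p.Monic)
    (hHp : Associated (e H) p) (u v : A) (hu : u ≠ 0) (huv : IsRelPrime u v) :
    (∀ z, H ∣ e.symm (Polynomial.C u) * z → H ∣ z) ∧
    (∀ s s', H ∣ e.symm (Polynomial.C v) * s - e.symm (Polynomial.C u) * s' →
      ∃ t, H ∣ s - e.symm (Polynomial.C u) * t) := by
  have tr : ∀ z, H ∣ z ↔ p ∣ e z := fun z => by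
    rw [← map_dvd_iff e, hHp.dvd_iff_dvd_left]
  have cm : ∀ (a : A) (f : Polynomial A), (Polynomial.C a * f) %ₘ p = Polynomial.C a * (f %ₘ p) := by
    intro a f
    rw [← Polynomial.smul_eq_C_mul, Polynomial.smul_modByMonic, Polynomial.smul_eq_C_mul]
  constructor
  · intro z hz
    rw [tr] at hz ⊢
    rw [map_mul, e.apply_symm_apply, ← Polynomial.modByMonic_eq_zero_iff_dvd hp, cm] at hz
    rw [← Polynomial.modByMonic_eq_zero_iff_dvd hp]
    exact (mul_eq_zero.mp hz).resolve_left (by simpa using hu)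
  · intro s s' hs
    rw [tr, map_sub, map_mul, map_mul, e.apply_symm_apply, e.apply_symm_apply,
      ← Polynomial.modByMonic_eq_zero_iff_dvd hp, Polynomial.sub_modByMonic, cm, cm,
      sub_eq_zero] at hs
    have : Polynomial.C u ∣ (e s %ₘ p) := by
      rw [Polynomial.C_dvd_iff_dvd_coeff]
      intro i
      have h1 := congrArg (fun f => Polynomial.coeff f i) hs
      simp only [Polynomial.coeff_C_mul] at h1
      exact huv.dvd_of_dvd_mul_left ⟨_, h1⟩
    obtain ⟨t, ht⟩ := this
    refine ⟨e.symm t, ?_⟩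
    rw [tr, map_sub, map_mul, e.apply_symm_apply, e.apply_symm_apply, ← ht,
      ← Polynomial.modByMonic_eq_zero_iff_dvd hp, Polynomial.sub_modByMonic,
      (Polynomial.modByMonic_eq_self_iff hp).mpr (Polynomial.degree_modByMonic_lt _ hp), sub_self]

/-- coprime pair -/
lemma exists_relPrime_pair {A : Type*} [CommRing A] [IsDomain A] [UniqueFactorizationMonoid A]
    (I : Ideal A) (hbot : I ≠ ⊥) (hI : ∀ π : A, Prime π → ¬ I ≤ Ideal.span {π}) :
    ∃ u ∈ I, ∃ v ∈ I, u ≠ 0 ∧ IsRelPrime u v := by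
  classical
  obtain ⟨u, huI, hu0⟩ := Submodule.exists_mem_ne_zero_of_ne_bot hbot
  have : ¬ ((I : Set A) ⊆ ⋃ i ∈ (↑(UniqueFactorizationMonoid.factors u).toFinset : Set A),
      (Ideal.span {i} : Ideal A)) := by
    rw [Ideal.subset_union_prime (s := (UniqueFactorizationMonoid.factors u).toFinset) (f := fun i => (Ideal.span {i} : Ideal A)) 0 0 ?_]
    · push Not
      intro i hi
      exact hI i (UniqueFactorizationMonoid.prime_of_factor i (by simpa using hi))
    · intro i hi _ _
      have := UniqueFactorizationMonoid.prime_of_factor i (by simpa using hi)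
      exact (Ideal.span_singleton_prime this.ne_zero).mpr this
  rw [Set.not_subset] at this
  obtain ⟨v, hvI, hv⟩ := this
  refine ⟨u, huI, v, hvI, hu0, ?_⟩
  rw [UniqueFactorizationMonoid.isRelPrime_iff_no_prime_factors hu0]
  intro π h1 h2 hπ
  apply hv
  obtain ⟨i, hi, hassoc⟩ := UniqueFactorizationMonoid.exists_mem_factors_of_dvd hu0 hπ.irreducible h1
  simp only [Set.mem_iUnion]
  refine ⟨i, by simpa using hi, ?_⟩
  simpa [Ideal.mem_span_singleton] using hassoc.symm.dvd.trans h2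

lemma aeval_mem_span {N : ℕ} (F : Fin N → MvPolynomial (Fin N) ℂ) (p : MvPolynomial (Fin N) ℂ)
    (m : ℕ) (hm : m ≠ 0) (hp : p.IsHomogeneous m) : aeval F p ∈ Ideal.span (Set.range F) := by
  rw [p.as_sum, map_sum]
  refine Ideal.sum_mem _ fun e he => ?_
  rw [aeval_monomial]
  refine Ideal.mul_mem_left _ _ ?_
  have hdeg : e.degree = m := by
    have := hp (mem_support_iff.mp he)
    rw [Finsupp.degree_eq_weight_one]; exact this
  have : ∃ i, e i ≠ 0 := by
    by_contra hcon
    push Not at hcon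
    have : e = 0 := Finsupp.ext hcon
    subst this
    simp at hdeg
    exact hm hdeg.symm
  obtain ⟨i, hi⟩ := this
  refine Ideal.mem_of_dvd _ (a := F i) ?_ (Ideal.subset_span ⟨i, rfl⟩)
  exact (dvd_pow_self _ hi).trans (Finset.dvd_prod_of_mem _ (Finsupp.mem_support_iff.mpr hi))

lemma exists_pow_mem {N : ℕ} (F : Fin N → MvPolynomial (Fin N) ℂ)
    (hF : ∀ x : Fin N → ℂ, (∀ i, eval x (F i) = 0) → x = 0) :
    ∃ K, 0 < K ∧ ∀ i, (X i : MvPolynomial (Fin N) ℂ) ^ K ∈ Ideal.span (Set.range F) := by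
  have h1 : ∀ i, (X i : MvPolynomial (Fin N) ℂ) ∈ (Ideal.span (Set.range F)).radical := by
    intro i
    rw [← vanishingIdeal_zeroLocus_eq_radical (K := ℂ)]
    rw [mem_vanishingIdeal_iff]
    intro x hx
    have : x = 0 := by
      apply hF
      intro j
      have := hx (F j) (Ideal.subset_span ⟨j, rfl⟩)
      simpa [aeval_eq_eval] using this
    simp [this]
  choose k hk using h1
  refine ⟨∑ i, k i + 1, by omega, fun i => ?_⟩
  refine Ideal.mem_of_dvd _ (pow_dvd_pow _ ?_) (hk i)
  have := Finset.single_le_sum (f := k) (fun _ _ => Nat.zero_le _) (Finset.mem_univ i)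
  omega

/-- `X i` is a nonzerodivisor modulo powers of the other variables. -/
lemma X_cancel {N K : ℕ} (i : Fin N) (p : MvPolynomial (Fin N) ℂ)
    (hp : X i * p ∈ Ideal.span ((fun k => (X k : MvPolynomial (Fin N) ℂ) ^ K) '' {k | k ≠ i})) :
    p ∈ Ideal.span ((fun k => (X k : MvPolynomial (Fin N) ℂ) ^ K) '' {k | k ≠ i}) := by
  have e : ((fun k => (X k : MvPolynomial (Fin N) ℂ) ^ K) '' {k | k ≠ i}) =
    ((fun s => monomial s (1 : ℂ)) '' ((fun k => Finsupp.single k K) '' {k | k ≠ i})) := by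
    rw [Set.image_image]
    simp [X_pow_eq_monomial]
  rw [e, mem_ideal_span_monomial_image] at hp ⊢
  intro x hx
  have := hp (Finsupp.single i 1 + x) (by
    rw [mem_support_iff] at hx ⊢
    rwa [coeff_X_mul])
  obtain ⟨_, ⟨k, hk, rfl⟩, h2⟩ := this
  refine ⟨_, ⟨k, hk, rfl⟩, ?_⟩
  intro l
  have := h2 l
  by_cases hl : l = k
  · subst hl
    have hk : l ≠ i := hk
    simpa [Finsupp.single_apply, hk.symm] using this
  · simp [Finsupp.single_apply, Ne.symm hl]

lemma det_mem_of_mulVec_mem {S m : Type*} [CommRing S] [Fintype m] [DecidableEq m] (I : Ideal S)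
    (D : Matrix m m S) (x : m → S) (hD : ∀ k, D.mulVec x k ∈ I) (j : m) : x j * D.det ∈ I := by
  have h1 : (D.adjugate.mulVec (D.mulVec x)) j = x j * D.det := by
    rw [Matrix.mulVec_mulVec, Matrix.adjugate_mul, Matrix.smul_mulVec, Matrix.one_mulVec, mul_comm]
    rfl
  rw [← h1]
  exact Ideal.sum_mem _ fun k _ => Ideal.mul_mem_left _ _ (hD k)

lemma wiebe_step {N K : ℕ} (i : Fin N) (C : Matrix (Fin N) (Fin N) (MvPolynomial (Fin N) ℂ))
    (r r' : Fin N → MvPolynomial (Fin N) ℂ) (hr : r ⬝ᵥ X = r' ⬝ᵥ X)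
    (hC : ∀ k, k ≠ i → C.mulVec X k = X k ^ K) :
    (C.updateRow i r).det - (C.updateRow i r').det ∈
      Ideal.span (Set.range fun k => (X k : MvPolynomial (Fin N) ℂ) ^ K) := by
  have h1 : (C.updateRow i r).det - (C.updateRow i r').det = (C.updateRow i (r - r')).det := by
    have := Matrix.det_updateRow_add C i (r - r') r'
    rw [sub_add_cancel] at this
    rw [this]; ring
  rw [h1]
  have h2 : (C.updateRow i (r - r')).det ∈
      Ideal.span ((fun k => (X k : MvPolynomial (Fin N) ℂ) ^ K) '' {k | k ≠ i}) := by
    apply X_cancel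
    apply det_mem_of_mulVec_mem
    intro k
    change (C.updateRow i (r - r') k) ⬝ᵥ X ∈ _
    by_cases hk : k = i
    · subst hk
      rw [Matrix.updateRow_self, sub_dotProduct, hr, sub_self]
      exact Ideal.zero_mem _
    · rw [Matrix.updateRow_ne hk]
      change C.mulVec X k ∈ _
      rw [hC k hk]
      exact Ideal.subset_span ⟨k, hk, rfl⟩
  refine Ideal.span_mono ?_ h2
  rintro _ ⟨k, _, rfl⟩
  exact ⟨k, rfl⟩

lemma wiebe_indep {N K : ℕ} (C C' : Matrix (Fin N) (Fin N) (MvPolynomial (Fin N) ℂ))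
    (hC : ∀ k, C.mulVec X k = X k ^ K) (hC' : ∀ k, C'.mulVec X k = X k ^ K) (s : Finset (Fin N)) :
    C.det - (Matrix.of fun i => if i ∈ s then C' i else C i).det ∈
      Ideal.span (Set.range fun k => (X k : MvPolynomial (Fin N) ℂ) ^ K) := by
  induction s using Finset.induction_on with
  | empty => 
    have : (Matrix.of fun i => if i ∈ (∅ : Finset (Fin N)) then C' i else C i) = C := by
      ext; simp
    rw [this, sub_self]; exact Ideal.zero_mem _
  | insert a s ha ih =>
    set M := (Matrix.of fun i => if i ∈ s then C' i else C i) with hM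
    have hMX : ∀ k, M.mulVec X k = X k ^ K := by
      intro k
      change M k ⬝ᵥ X = _
      by_cases hk : k ∈ s
      · have : M k = C' k := by rw [hM]; exact if_pos hk
        rw [this]; exact hC' k
      · have : M k = C k := by rw [hM]; exact if_neg hk
        rw [this]; exact hC k
    have h1 : M = M.updateRow a (C a) := by
      have h0 : M a = C a := by rw [hM]; exact if_neg ha
      rw [← h0, Matrix.updateRow_eq_self]
    have h2 : (Matrix.of fun i => if i ∈ insert a s then C' i else C i) = M.updateRow a (C' a) := by
      ext1 k
      by_cases hk : k = a
      · subst hk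
        rw [Matrix.updateRow_self]
        exact fun _ => congrFun (if_pos (Finset.mem_insert_self k s)) _
      · rw [Matrix.updateRow_ne hk]
        intro l
        simp [hM, hk]
    have := wiebe_step (K := K) a M (C a) (C' a)
      ((hC a).trans (hC' a).symm) (fun k _ => hMX k)
    rw [← h1, ← h2] at this
    have := Ideal.add_mem _ ih this
    simpa using this

lemma prod_not_mem {N K : ℕ} (hK : 0 < K) :
    ∏ i, (X i : MvPolynomial (Fin N) ℂ) ^ (K - 1) ∉
      Ideal.span (Set.range fun k => (X k : MvPolynomial (Fin N) ℂ) ^ K) := by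
  intro h
  have e : (Set.range fun k => (X k : MvPolynomial (Fin N) ℂ) ^ K) =
    ((fun s => monomial s (1 : ℂ)) '' (Set.range (fun k => Finsupp.single k K))) := by
    rw [← Set.range_comp]
    simp [X_pow_eq_monomial, Function.comp_def]
  have e2 : ∏ i, (X i : MvPolynomial (Fin N) ℂ) ^ (K - 1) =
      monomial (∑ i, Finsupp.single i (K - 1)) 1 := by
    rw [monomial_sum_one]
    simp [X_pow_eq_monomial]
  rw [e, e2, mem_ideal_span_monomial_image] at h
  obtain ⟨_, ⟨k, rfl⟩, hk⟩ := h (∑ i, Finsupp.single i (K - 1)) (by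
    rw [mem_support_iff, coeff_monomial, if_pos rfl]; exact one_ne_zero)
  have := hk k
  rw [Finsupp.finsetSum_apply, Finsupp.single_eq_same, Finset.sum_eq_single k
    (fun b _ hb => by simp [hb.symm]) (by simp), Finsupp.single_eq_same] at this
  omega

lemma wiebe {N q : ℕ} (hq : q ≠ 0) (F : Fin N → MvPolynomial (Fin N) ℂ)
    (hhom : ∀ i, (F i).IsHomogeneous q)
    (hF : ∀ x : Fin N → ℂ, (∀ i, eval x (F i) = 0) → x = 0) :
    (Matrix.of fun j i => pderiv j (F i)).det ∉ Ideal.span (Set.range F) := by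
  intro hdet
  obtain ⟨K, hK, hmem⟩ := exists_pow_mem F hF
  have : ∀ i, ∃ c : Fin N → MvPolynomial (Fin N) ℂ, ∑ j, c j * F j = X i ^ K := fun i =>
    Ideal.mem_span_range_iff_exists_fun.mp (hmem i)
  choose B hB using this
  set A : Matrix (Fin N) (Fin N) (MvPolynomial (Fin N) ℂ) :=
    (C (q : ℂ)⁻¹ : MvPolynomial (Fin N) ℂ) • (Matrix.of fun j i => pderiv j (F i)).transpose with hA
  have hAX : A.mulVec X = F := by
    funext i
    rw [hA, Matrix.smul_mulVec]
    have := (hhom i).sum_X_mul_pderiv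
    have h2 : (Matrix.mulVec (Matrix.of fun j i => pderiv j (F i)).transpose X) i = q • F i := by
      rw [← this]
      simp [Matrix.mulVec, dotProduct, mul_comm]
    rw [Pi.smul_apply, h2, smul_eq_mul, nsmul_eq_mul, ← mul_assoc,
      ← map_natCast (C : ℂ →+* MvPolynomial (Fin N) ℂ), ← C_mul,
      inv_mul_cancel₀ (by exact_mod_cast hq), C_1, one_mul]
  have hAdet : A.det ∈ Ideal.span (Set.range F) := by
    rw [hA, Matrix.det_smul, Matrix.det_transpose]
    exact Ideal.mul_mem_left _ _ hdet
  set Bm : Matrix (Fin N) (Fin N) (MvPolynomial (Fin N) ℂ) := Matrix.of B with hBm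
  have hBF : ∀ k, Bm.mulVec F k = X k ^ K := fun k => hB k
  have hBA : (Bm * A).det ∈ Ideal.span (Set.range fun k => (X k : MvPolynomial (Fin N) ℂ) ^ K) := by
    rw [Matrix.det_mul]
    have : ∀ x ∈ Ideal.span (Set.range F), Bm.det * x ∈
        Ideal.span (Set.range fun k => (X k : MvPolynomial (Fin N) ℂ) ^ K) := by
      intro x hx
      induction hx using Submodule.span_induction with
      | mem x hx =>
        obtain ⟨j, rfl⟩ := hx
        rw [mul_comm]
        exact det_mem_of_mulVec_mem _ _ _ (fun k => by
          rw [hBF]; exact Ideal.subset_span ⟨k, rfl⟩) j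
      | zero => simp
      | add x y _ _ hx hy => rw [mul_add]; exact Ideal.add_mem _ hx hy
      | smul a x _ hx =>
        rw [smul_eq_mul, mul_left_comm]; exact Ideal.mul_mem_left _ _ hx
    exact this _ hAdet
  have h3 := wiebe_indep (K := K) (Bm * A)
    (Matrix.diagonal fun i => (X i : MvPolynomial (Fin N) ℂ) ^ (K - 1))
    (fun k => by rw [← Matrix.mulVec_mulVec, hAX]; exact hBF k)
    (fun k => by
      rw [Matrix.mulVec_diagonal, ← pow_succ, Nat.sub_add_cancel hK]) Finset.univ
  have h4 : (Matrix.of fun i => if i ∈ Finset.univ then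
    (Matrix.diagonal fun i => (X i : MvPolynomial (Fin N) ℂ) ^ (K - 1)) i else (Bm * A) i) =
    (Matrix.diagonal fun i => (X i : MvPolynomial (Fin N) ℂ) ^ (K - 1)) := by
    ext; simp
  rw [h4, Matrix.det_diagonal] at h3
  have h5 := Ideal.sub_mem _ hBA h3
  rw [sub_sub_cancel] at h5
  exact prod_not_mem hK h5

lemma dim_le_of_integral {R S : Type*} [CommRing R] [CommRing S] (f : R →+* S)
    (hf : f.IsIntegral) : ringKrullDim S ≤ ringKrullDim R := by
  let _ : Algebra R S := f.toAlgebra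
  have : Algebra.IsIntegral R S := ⟨hf⟩
  exact Order.krullDim_le_of_strictMono (PrimeSpectrum.comap (algebraMap R S))
    (fun I J hIJ => Ideal.IsIntegral.comap_lt_comap (R := R) (A := S) hIJ)

lemma dim_quot_le_of_integral {R S : Type*} [CommRing R] [CommRing S] (f : R →+* S)
    (hf : f.IsIntegral) (P : Ideal R) (hP : RingHom.ker f ≤ P) :
    ringKrullDim (R ⧸ P) ≤ ringKrullDim S := by
  let _ : Algebra R S := f.toAlgebra
  have : Algebra.IsIntegral R S := ⟨hf⟩
  refine iSup_le fun l => ?_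
  let l' : LTSeries (PrimeSpectrum R) := l.map (PrimeSpectrum.comap (Ideal.Quotient.mk P))
    (fun I J hIJ => lt_of_le_of_ne (Ideal.comap_mono (show I.asIdeal ≤ J.asIdeal from hIJ.le))
      (fun h => hIJ.ne (PrimeSpectrum.comap_injective_of_surjective _
        Ideal.Quotient.mk_surjective h)))
  have hl' : (⊥ : Ideal S).comap (algebraMap R S) ≤ l'.head.asIdeal := by
    intro x hx
    have hx : x ∈ P := hP hx
    change Ideal.Quotient.mk P x ∈ l.head.asIdeal
    rw [Ideal.Quotient.eq_zero_iff_mem.mpr hx]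
    exact Ideal.zero_mem _
  obtain ⟨Q, -, hQ, hQc⟩ := Ideal.exists_ideal_over_prime_of_isIntegral l'.head.asIdeal ⊥ hl'
  have : Q.LiesOver l'.head.asIdeal := ⟨hQc.symm⟩
  obtain ⟨L, hL, -⟩ := Ideal.exists_ltSeries_of_hasGoingUp l' Q
  refine le_trans (le_of_eq ?_) (le_iSup _ L)
  rw [hL]; rfl

lemma height_maximal (n : ℕ) (M : Ideal (MvPolynomial (Fin n) ℂ)) [hM : M.IsMaximal] :
    M.height = n := by
  induction n with
  | zero =>
    have : IsField (MvPolynomial (Fin 0) ℂ) :=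
      (isEmptyRingEquiv ℂ (Fin 0)).toMulEquiv.isField (Field.toIsField ℂ)
    let _ := this.toField
    have : M = ⊥ := (Ideal.eq_bot_or_top M).resolve_right hM.ne_top
    subst this
    simp
  | succ n ih =>
    let e := (finSuccEquiv ℂ n).toRingEquiv
    let M' : Ideal (Polynomial (MvPolynomial (Fin n) ℂ)) := M.map e
    have : M'.IsMaximal := Ideal.map_isMaximal_of_equiv e
    have h1 : M'.height = M.height := e.height_map M
    let p := M'.comap (Polynomial.C : MvPolynomial (Fin n) ℂ →+* _)
    have hp : p.IsMaximal := Polynomial.isMaximal_comap_C_of_isJacobsonRing M'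
    have : M'.LiesOver p := ⟨rfl⟩
    rw [← h1, Polynomial.height_eq_height_add_one p M', ih p]
    simp

lemma dim_quot_prime (n : ℕ) (π : MvPolynomial (Fin n) ℂ) (hπ : Prime π) :
    (n : WithBot ℕ∞) ≤ ringKrullDim (MvPolynomial (Fin n) ℂ ⧸ Ideal.span {π}) + 1 := by
  obtain ⟨M, hM, hle⟩ := Ideal.exists_le_maximal (Ideal.span {π})
    (by rw [Ne, Ideal.span_singleton_eq_top]; exact hπ.not_isUnit)
  have := Ideal.height_le_ringKrullDim_quotient_add_one (hle (Ideal.mem_span_singleton_self π))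
  rw [height_maximal n M] at this
  exact_mod_cast this

lemma homComp_mul {N q K : ℕ} (f B : MvPolynomial (Fin N) ℂ) (hf : f.IsHomogeneous q) (hK : q ≤ K) :
    homogeneousComponent K (B * f) = homogeneousComponent (K - q) B * f := by
  conv_lhs => rw [← sum_homogeneousComponent B, Finset.sum_mul, map_sum]
  have : ∀ i, homogeneousComponent K (homogeneousComponent i B * f) =
      if i = K - q then homogeneousComponent i B * f else 0 := by
    intro i
    rw [homogeneousComponent_of_mem ((homogeneousComponent_isHomogeneous i B).mul hf)]
    by_cases h : i = K - q
    · rw [if_pos h, if_pos (by omega)]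
    · rw [if_neg h, if_neg (by omega)]
  simp only [this]
  rw [Finset.sum_ite_eq']
  split_ifs with h
  · rfl
  · rw [homogeneousComponent_eq_zero _ _ (by simp at h; omega), zero_mul]

lemma aeval_isIntegral {N q K : ℕ} (hq : 0 < q) (F : Fin N → MvPolynomial (Fin N) ℂ)
    (hhom : ∀ i, (F i).IsHomogeneous q)
    (hK : ∀ i, (X i : MvPolynomial (Fin N) ℂ) ^ K ∈ Ideal.span (Set.range F)) :
    (aeval F : MvPolynomial (Fin N) ℂ →ₐ[ℂ] MvPolynomial (Fin N) ℂ).toRingHom.IsIntegral := by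
  classical
  wlog hqK : q ≤ K generalizing K
  · exact this (K := K + q) (fun i => by
      rw [pow_add]; exact Ideal.mul_mem_right _ _ (hK i)) (by omega)
  have hB : ∀ i, ∃ c : Fin N → MvPolynomial (Fin N) ℂ, (∀ j, (c j).IsHomogeneous (K - q)) ∧
      X i ^ K = ∑ j, c j * F j := by
    intro i
    obtain ⟨c, hc⟩ := Ideal.mem_span_range_iff_exists_fun.mp (hK i)
    refine ⟨fun j => homogeneousComponent (K - q) (c j),
      fun j => homogeneousComponent_isHomogeneous _ _, ?_⟩
    have h1 : homogeneousComponent K ((X i : MvPolynomial (Fin N) ℂ) ^ K) = X i ^ K := by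
      rw [homogeneousComponent_of_mem (n := K) (isHomogeneous_X_pow i K), if_pos rfl]
    rw [← h1, ← hc, map_sum]
    exact Finset.sum_congr rfl fun j _ => homComp_mul _ _ (hhom j) hqK
  choose B hBh hB using hB
  set R := (aeval F : MvPolynomial (Fin N) ℂ →ₐ[ℂ] MvPolynomial (Fin N) ℂ).range with hR
  have hFR : ∀ j, F j ∈ R := fun j => ⟨X j, by simp⟩
  set T : Set (MvPolynomial (Fin N) ℂ) :=
    (fun e => monomial e (1 : ℂ)) '' (Set.Iic (Finsupp.equivFunOnFinite.symm fun _ => K)) with hT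
  have hTf : T.Finite := (Set.finite_Iic _).image _
  set V : Submodule R (MvPolynomial (Fin N) ℂ) := Submodule.span R T with hV
  have hCV : ∀ (c : ℂ) x, x ∈ V → C c * x ∈ V := by
    intro c x hx
    have := V.smul_mem (⟨C c, R.algebraMap_mem c⟩ : R) hx
    exact this
  have hmono : ∀ m : ℕ, ∀ e : Fin N →₀ ℕ, e.degree = m → monomial e (1 : ℂ) ∈ V := by
    intro m
    induction m using Nat.strong_induction_on with
    | _ m ih =>
      intro e he
      by_cases hle : e ≤ (Finsupp.equivFunOnFinite.symm fun _ => K)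
      · exact Submodule.subset_span ⟨e, hle, rfl⟩
      · have : ∃ i, K < e i := by
          by_contra hcon
          push Not at hcon
          exact hle fun i => by simpa using hcon i
        obtain ⟨i, hi⟩ := this
        have hsplit : e = (e - Finsupp.single i K) + Finsupp.single i K := by
          rw [tsub_add_cancel_of_le]
          rw [Finsupp.single_le_iff]; exact hi.le
        set e' := e - Finsupp.single i K with he'
        have hdeg : e'.degree + K = m := by
          rw [← he]; conv_rhs => rw [hsplit]
          rw [map_add, Finsupp.degree_single]
        have h1 : monomial e (1 : ℂ) = ∑ j, F j * (monomial e' 1 * B i j) := by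
          rw [hsplit, ← mul_one (1 : ℂ), ← monomial_mul, mul_one, ← X_pow_eq_monomial, hB i,
            Finset.mul_sum]
          exact Finset.sum_congr rfl fun j _ => by ring
        rw [h1]
        refine V.sum_mem fun j _ => ?_
        refine V.smul_mem (⟨F j, hFR j⟩ : R) ?_
        have h2 : (monomial e' (1 : ℂ) * B i j).IsHomogeneous (e'.degree + (K - q)) :=
          (isHomogeneous_monomial _ rfl).mul (hBh i j)
        rw [(monomial e' (1 : ℂ) * B i j).as_sum]
        refine V.sum_mem fun e'' he'' => ?_
        rw [← mul_one (coeff _ _), ← C_mul_monomial]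
        apply hCV
        apply ih e''.degree _ _ rfl
        have := h2 (mem_support_iff.mp he'')
        have h3 : e''.degree = e'.degree + (K - q) := by
          have hw : e''.degree = Finsupp.weight 1 e'' := by
            rw [Finsupp.degree_eq_weight_one]; rfl
          exact hw.trans this
        omega
  have htop : V = ⊤ := by
    rw [eq_top_iff]
    intro x _
    rw [x.as_sum]
    refine V.sum_mem fun e _ => ?_
    rw [← mul_one (coeff _ _), ← C_mul_monomial]
    exact hCV _ _ (hmono _ e rfl)
  have hfin : Module.Finite R (MvPolynomial (Fin N) ℂ) :=
    ⟨⟨hTf.toFinset, by rw [Set.Finite.coe_toFinset]; exact htop⟩⟩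
  have hint : (algebraMap R (MvPolynomial (Fin N) ℂ)).IsIntegral :=
    algebraMap_isIntegral_iff.mpr (Algebra.IsIntegral.of_finite _ _)
  have hsurj : (aeval F : MvPolynomial (Fin N) ℂ →ₐ[ℂ] MvPolynomial (Fin N) ℂ).rangeRestrict.toRingHom.IsIntegral :=
    RingHom.isIntegral_of_surjective _ (AlgHom.rangeRestrict_surjective _)
  exact hsurj.trans _ _ hint
namespace NN
open Polynomial MvPolynomial Ideal Nat RingHom List
variable {k : Type*} [Field k] {n : ℕ} (f : MvPolynomial (Fin (n + 1)) k)
variable (v w : Fin (n + 1) →₀ ℕ)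

variable {f v} in
lemma lt_up (vlt : ∀ i, v i < (2 + f.totalDegree)) : ∀ l ∈ ofFn v, l < (2 + f.totalDegree) := by
  grind





noncomputable abbrev T1 (c : k) :
    MvPolynomial (Fin (n + 1)) k →ₐ[k] MvPolynomial (Fin (n + 1)) k :=
  aeval fun i ↦ if i = 0 then X 0 else X i + c • X 0 ^ ((2 + f.totalDegree) ^ i.1)

lemma t1_comp_t1_neg (c : k) : (T1 f c).comp (T1 f (-c)) = AlgHom.id _ _ := by
  rw [comp_aeval, ← MvPolynomial.aeval_X_left]
  ext i v
  cases i using Fin.cases <;> simp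


noncomputable abbrev T := AlgEquiv.ofAlgHom (T1 f 1) (T1 f (-1))
  (t1_comp_t1_neg f 1) (by simpa using t1_comp_t1_neg f (-1))

lemma sum_r_mul_ne (vlt : ∀ i, v i < (2 + f.totalDegree)) (wlt : ∀ i, w i < (2 + f.totalDegree)) (ne : v ≠ w) :
    ∑ x : Fin (n + 1), (2 + f.totalDegree) ^ x.1 * v x ≠ ∑ x : Fin (n + 1), (2 + f.totalDegree) ^ x.1 * w x := by
  intro h
  refine ne <| Finsupp.ext <| congrFun <| ofFn_inj.mp ?_
  apply ofDigits_inj_of_len_eq (Nat.lt_add_right f.totalDegree one_lt_two)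
    (by simp) (lt_up vlt) (lt_up wlt)
  simpa only [ofDigits_eq_sum_mapIdx, mapIdx_eq_ofFn, get_ofFn, length_ofFn,
    Fin.val_cast, mul_comm, sum_ofFn] using! h

lemma degreeOf_zero_t {a : k} (ha : a ≠ 0) : ((T f) (monomial v a)).degreeOf 0 =
    ∑ i : Fin (n + 1), (2 + f.totalDegree) ^ i.1 * v i := by
  rw [← natDegree_finSuccEquiv, monomial_eq, Finsupp.prod_pow v fun a ↦ X a]
  simp only [Fin.prod_univ_succ, Fin.sum_univ_succ, map_mul, map_prod, map_pow,
    AlgEquiv.ofAlgHom_apply, MvPolynomial.aeval_C, MvPolynomial.aeval_X, if_pos, Fin.succ_ne_zero,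
    ite_false, one_smul, map_add, finSuccEquiv_X_zero, finSuccEquiv_X_succ, algebraMap_eq]
  have h (i : Fin n) :
      (Polynomial.C (X (R := k) i) + Polynomial.X ^ ((2 + f.totalDegree) ^ (i.succ : Fin (n+1)).1)) ^ v i.succ ≠ 0 :=
    pow_ne_zero (v i.succ) (leadingCoeff_ne_zero.mp <| by simp [add_comm, leadingCoeff_X_pow_add_C])
  rw [natDegree_mul (by simp [ha]) (mul_ne_zero (by simp) (Finset.prod_ne_zero_iff.mpr
    (fun i _ ↦ h i))), natDegree_mul (by simp) (Finset.prod_ne_zero_iff.mpr (fun i _ ↦ h i)),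
    natDegree_prod _ _ (fun i _ ↦ h i), natDegree_finSuccEquiv, degreeOf_C]
  simpa only [natDegree_pow, zero_add, natDegree_X, mul_one, Fin.val_zero, pow_zero, one_mul,
    add_right_inj] using Finset.sum_congr rfl (fun i _ ↦ by
    rw [add_comm (Polynomial.C _), natDegree_X_pow_add_C, mul_comm])


lemma degreeOf_t_ne_of_ne (hv : v ∈ f.support) (hw : w ∈ f.support) (ne : v ≠ w) :
    (T f <| monomial v <| coeff v f).degreeOf 0 ≠
    (T f <| monomial w <| coeff w f).degreeOf 0 := by
  rw [degreeOf_zero_t _ _ <| mem_support_iff.mp hv, degreeOf_zero_t _ _ <| mem_support_iff.mp hw]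
  refine sum_r_mul_ne f v w (fun i ↦ ?_) (fun i ↦ ?_) ne <;>
  exact lt_of_le_of_lt ((monomial_le_degreeOf i ‹_›).trans (degreeOf_le_totalDegree f i))
    (by lia)

lemma leadingCoeff_finSuccEquiv_t :
    (finSuccEquiv k n ((T f) ((monomial v) (coeff v f)))).leadingCoeff =
    algebraMap k _ (coeff v f) := by
  rw [monomial_eq, Finsupp.prod_fintype]
  · simp only [map_mul, map_prod, leadingCoeff_mul, leadingCoeff_prod]
    rw [AlgEquiv.ofAlgHom_apply, algHom_C, algebraMap_eq, finSuccEquiv_apply,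
      eval₂Hom_C, coe_comp]
    simp only [AlgEquiv.ofAlgHom_apply, Function.comp_apply, leadingCoeff_C, map_pow,
      leadingCoeff_pow, algebraMap_eq]
    have : ∀ j, ((finSuccEquiv k n) ((T1 f) 1 (X j))).leadingCoeff = 1 := fun j ↦ by
      by_cases h : j = 0
      · simp [h, finSuccEquiv_apply]
      · simp only [aeval_eq_bind₁, bind₁_X_right, if_neg h, one_smul, map_add, map_pow]
        obtain ⟨i, rfl⟩ := Fin.exists_succ_eq.mpr h
        simp [finSuccEquiv_X_succ, finSuccEquiv_X_zero, add_comm]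
    simp only [this, one_pow, Finset.prod_const_one, mul_one]
  exact fun i ↦ pow_zero _


lemma T_leadingcoeff_isUnit (fne : f ≠ 0) :
    IsUnit (finSuccEquiv k n (T f f)).leadingCoeff := by
  obtain ⟨v, vin, vs⟩ := Finset.exists_max_image f.support
    (fun v ↦ (T f ((monomial v) (coeff v f))).degreeOf 0) (support_nonempty.mpr fne)
  set h := fun w ↦ (MvPolynomial.monomial w) (coeff w f)
  simp only [← natDegree_finSuccEquiv] at vs
  replace vs : ∀ x ∈ f.support \ {v}, (finSuccEquiv k n ((T f) (h x))).degree <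
      (finSuccEquiv k n ((T f) (h v))).degree := by
    intro x hx
    obtain ⟨h1, h2⟩ := Finset.mem_sdiff.mp hx
    apply degree_lt_degree <| lt_of_le_of_ne (vs x h1) ?_
    simpa only [natDegree_finSuccEquiv]
      using degreeOf_t_ne_of_ne f _ _ h1 vin <| ne_of_not_mem_cons h2
  have coeff : (finSuccEquiv k n ((T f) (h v + ∑ x ∈ f.support \ {v}, h x))).leadingCoeff =
      (finSuccEquiv k n ((T f) (h v))).leadingCoeff := by
    simp only [map_add, map_sum]
    rw [add_comm]
    apply leadingCoeff_add_of_degree_lt <| (lt_of_le_of_lt <| degree_sum_le _ _) ?_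
    have h2 : h v ≠ 0 := by simpa [h] using mem_support_iff.mp vin
    replace h2 : (finSuccEquiv k n ((T f) (h v))) ≠ 0 := fun eq ↦ h2 <|
      by simpa only [map_eq_zero_iff _ (AlgEquiv.injective _)] using eq
    exact (Finset.sup_lt_iff <| Ne.bot_lt (fun x ↦ h2 <| degree_eq_bot.mp x)).mpr vs
  nth_rw 2 [← f.support_sum_monomial_coeff]
  rw [Finset.sum_eq_add_sum_sdiff_singleton_of_mem vin h]
  rw [leadingCoeff_finSuccEquiv_t] at coeff
  simpa only [coeff, algebraMap_eq] using (mem_support_iff.mp vin).isUnit.map MvPolynomial.C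

end NN

lemma int_of_monic {A B : Type*} [CommRing A] [CommRing B] (φ : Polynomial A →+* B)
    (hφ : Function.Surjective φ) (p : Polynomial A) (hp : p.Monic) (h0 : φ p = 0) :
    (φ.comp Polynomial.C).IsIntegral := by
  have h1 := hp.quotient_isIntegral (I := RingHom.ker φ) h0
  have h2 : (RingHom.kerLift φ).IsIntegral :=
    RingHom.isIntegral_of_surjective _ fun b => by
      obtain ⟨a, rfl⟩ := hφ b
      exact ⟨Ideal.Quotient.mk _ a, rfl⟩
  have h3 := RingHom.IsIntegral.trans
    ((Ideal.Quotient.mk (RingHom.ker φ)).comp (algebraMap A (Polynomial A))) (RingHom.kerLift φ) h1 h2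
  exact h3

lemma pderiv_aeval' {N : ℕ} (F : Fin N → MvPolynomial (Fin N) ℂ) (j : Fin N)
    (p : MvPolynomial (Fin N) ℂ) :
    pderiv j (aeval F p) = ∑ i, pderiv j (F i) * aeval F (pderiv i p) := by
  induction p using MvPolynomial.induction_on with
  | C a => simp
  | add p q hp hq => simp only [map_add, hp, hq, mul_add, Finset.sum_add_distrib]
  | mul_X p i hp =>
    rw [map_mul, aeval_X, Derivation.leibniz, hp]
    simp only [Derivation.leibniz, smul_eq_mul, map_add, map_mul, aeval_X, mul_add,
      Finset.sum_add_distrib, pderiv_X]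
    have : ∑ x, pderiv j (F x) * (aeval F p * aeval F ((Pi.single x 1 : Fin N → MvPolynomial (Fin N) ℂ) i))
        = aeval F p * pderiv j (F i) := by
      rw [Finset.sum_eq_single i]
      · simp [mul_comm]
      · intro b _ hb
        rw [Pi.single_eq_of_ne hb.symm]; simp
      · simp
    have h2 : F i * ∑ x, pderiv j (F x) * aeval F (pderiv x p) =
        ∑ x, pderiv j (F x) * (F i * aeval F (pderiv x p)) := by
      rw [Finset.mul_sum]
      exact Finset.sum_congr rfl fun x _ => mul_left_comm _ _ _
    rw [this, h2]

lemma exists_monic_equiv (n : ℕ) (h : MvPolynomial (Fin (n + 1)) ℂ) (h0 : h ≠ 0) :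
    ∃ (e : MvPolynomial (Fin (n + 1)) ℂ ≃+* Polynomial (MvPolynomial (Fin n) ℂ))
      (p : Polynomial (MvPolynomial (Fin n) ℂ)), p.Monic ∧ Associated (e h) p := by
  have u := NN.T_leadingcoeff_isUnit h h0
  refine ⟨((NN.T h).trans (finSuccEquiv ℂ n)).toRingEquiv, _,
    Polynomial.monic_of_isUnit_leadingCoeff_inv_smul u, ?_⟩
  refine ⟨Units.map (Polynomial.C : MvPolynomial (Fin n) ℂ →+* _).toMonoidHom u.unit⁻¹, ?_⟩
  rw [Units.smul_def, Polynomial.smul_eq_C_mul, mul_comm]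
  rfl

/-- A totally invariant irreducible hypersurface of `ℙⁿ` (`n ≥ 6`) whose singular locus has
dimension at most `1` (Jacobian ring of Krull dimension `≤ 2`) is a hyperplane. -/
theorem one_dim_singularities_linear (n : ℕ) (hn : 6 ≤ n) (d : ℕ)
    (h : MvPolynomial (Fin (n + 1)) ℂ) (hirr : Irreducible h) (hhom : h.IsHomogeneous d)
    (hdim : ringKrullDim (MvPolynomial (Fin (n + 1)) ℂ ⧸ jacobianIdeal (n + 1) h) ≤ 2)
    (hinv : IsTotallyInvariant (n + 1) h) :
    d = 1 := by
  obtain ⟨q, hq, F, ⟨hFh, hF0⟩, lam, hlam, hinv⟩ := hinv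
  by_contra hd1
  have hd0 : d ≠ 0 := by
    rintro rfl
    apply hirr.not_isUnit
    have h1 := hhom
    rw [← totalDegree_zero_iff_isHomogeneous, totalDegree_eq_zero_iff_eq_C] at h1
    have h2 : coeff 0 h ≠ 0 := fun h3 => hirr.ne_zero (by rw [h1, h3, map_zero])
    rw [h1]
    exact (IsUnit.mk0 _ h2).map C
  have hd : d - 1 ≠ 0 := by omega
  set H := h ^ (q - 1) with hHdef
  have hH0 : H ≠ 0 := pow_ne_zero _ hirr.ne_zero
  have hHq : h ^ q = H * h := by rw [hHdef, ← pow_succ]; congr 1; omega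
  set α : Fin (n + 1) → MvPolynomial (Fin (n + 1)) ℂ := fun i => aeval F (pderiv i h) with hα
  set D : Matrix (Fin (n + 1)) (Fin (n + 1)) (MvPolynomial (Fin (n + 1)) ℂ) :=
    Matrix.of fun j i => pderiv j (F i) with hDdef
  have hD : D.mulVec α = fun k => H * (C (lam * q) * pderiv k h) := by
    funext k
    have h1 := pderiv_aeval' F k h
    rw [hinv] at h1
    have h2 : D.mulVec α k = ∑ i, pderiv k (F i) * aeval F (pderiv i h) := rfl
    rw [h2, ← h1, pderiv_C_mul, pderiv_pow, map_mul, map_natCast]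
    ring
  set 𝔟 : Ideal (MvPolynomial (Fin (n + 1)) ℂ) := Ideal.span (insert H (Set.range α)) with h𝔟
  have hH𝔟 : H ∈ 𝔟 := Ideal.subset_span (Set.mem_insert _ _)
  obtain ⟨K, -, hK⟩ := exists_pow_mem F hF0
  -- dimension of the quotient by `𝔟`
  have hle : jacobianIdeal (n + 1) h ≤
      𝔟.comap (aeval F : MvPolynomial (Fin (n + 1)) ℂ →ₐ[ℂ] MvPolynomial (Fin (n + 1)) ℂ).toRingHom := by
    rw [jacobianIdeal, Ideal.span_le]
    rintro x (rfl | ⟨i, rfl⟩)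
    · change aeval F x ∈ 𝔟
      rw [hinv, hHq]
      exact Ideal.mul_mem_left _ _ (Ideal.mul_mem_right _ _ hH𝔟)
    · exact Ideal.subset_span (Set.mem_insert_of_mem _ ⟨i, rfl⟩)
  have hdimb : ringKrullDim (MvPolynomial (Fin (n + 1)) ℂ ⧸ 𝔟) ≤ 2 := by
    refine le_trans (dim_le_of_integral (Ideal.quotientMap 𝔟 _ hle) ?_) hdim
    have h1 := aeval_isIntegral (by omega : 0 < q) F hFh hK
    have h2 := h1.trans _ _ (RingHom.isIntegral_of_surjective (Ideal.Quotient.mk 𝔟)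
      Ideal.Quotient.mk_surjective)
    refine RingHom.IsIntegral.tower_top (Ideal.Quotient.mk (jacobianIdeal (n + 1) h)) _ ?_
    rw [Ideal.quotientMap_comp_mk]
    exact h2
  obtain ⟨e, p0, hp0, hassoc⟩ := exists_monic_equiv n h hirr.ne_zero
  have hpm : (p0 ^ (q - 1)).Monic := hp0.pow _
  have hassocH : Associated (e H) (p0 ^ (q - 1)) := by
    rw [hHdef, map_pow]; exact hassoc.pow_pow
  let φ : Polynomial (MvPolynomial (Fin n) ℂ) →+* MvPolynomial (Fin (n + 1)) ℂ ⧸ 𝔟 :=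
    (Ideal.Quotient.mk 𝔟).comp e.symm.toRingHom
  have hφs : Function.Surjective φ :=
    Ideal.Quotient.mk_surjective.comp e.symm.surjective
  have hφ0 : φ (p0 ^ (q - 1)) = 0 := by
    obtain ⟨w, hw⟩ := hassocH
    rw [← hw, map_mul]
    have : φ (e H) = 0 := by
      change Ideal.Quotient.mk 𝔟 (e.symm (e H)) = 0
      rw [e.symm_apply_apply]
      exact Ideal.Quotient.eq_zero_iff_mem.mpr hH𝔟
    rw [this, zero_mul]
  have hint := int_of_monic φ hφs _ hpm hφ0
  have hker : ∀ π : MvPolynomial (Fin n) ℂ, Prime π →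
      ¬ RingHom.ker (φ.comp Polynomial.C) ≤ Ideal.span {π} := by
    intro π hπ hcon
    have h1 := dim_quot_le_of_integral _ hint _ hcon
    have h2 := dim_quot_prime n π hπ
    have h3 : (n : WithBot ℕ∞) ≤ 2 + 1 :=
      h2.trans (add_le_add_left (h1.trans hdimb) 1)
    have h4 : (n : WithBot ℕ∞) ≤ ((3 : ℕ) : WithBot ℕ∞) := h3.trans (by norm_num)
    have h5 : n ≤ 3 := by exact_mod_cast h4
    omega
  have hbot : RingHom.ker (φ.comp Polynomial.C) ≠ ⊥ := by
    intro hcon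
    have hn0 : 0 < n := by omega
    exact hker (X ⟨0, hn0⟩) (MvPolynomial.X_prime) (hcon ▸ bot_le)
  obtain ⟨u, hu, v, hv, hu0, huv⟩ := exists_relPrime_pair _ hbot hker
  have hmem : ∀ a ∈ RingHom.ker (φ.comp Polynomial.C),
      (e.symm.toRingHom.comp Polynomial.C) a ∈ 𝔟 := fun a ha =>
    Ideal.Quotient.eq_zero_iff_mem.mp ha
  obtain ⟨R1, R2⟩ := reg_of_monic e H _ hpm hassocH u v hu0 huv
  obtain ⟨C1, C2⟩ := koszul_cancel (e.symm.toRingHom.comp Polynomial.C) α H u v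
    (hmem u hu) (hmem v hv) R1 R2
  obtain ⟨t, b, hdet⟩ := core_alg D α _ H hH0 hD C1 C2
  refine wiebe (by omega : q ≠ 0) F hFh hF0 ?_
  change D.det ∈ _
  have hαm : ∀ i, α i ∈ Ideal.span (Set.range F) := fun i =>
    aeval_mem_span F _ (d - 1) hd hhom.pderiv
  have hhq : h ^ q ∈ Ideal.span (Set.range F) := by
    have h1 := Ideal.mul_mem_left _ (C lam⁻¹) (aeval_mem_span F h d hd0 hhom)
    rwa [hinv, ← mul_assoc, ← C_mul, inv_mul_cancel₀ hlam, C_1, one_mul] at h1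
  have hDm : ∀ k, D.mulVec α k ∈ Ideal.span (Set.range F) := fun k => by
    rw [Matrix.mulVec, dotProduct]
    exact Ideal.sum_mem _ fun i _ => Ideal.mul_mem_left _ _ (hαm i)
  rw [hdet]
  refine Ideal.add_mem _ (Ideal.sum_mem _ fun k _ => Ideal.mul_mem_left _ _
    (hDm k)) (Ideal.mul_mem_right _ _ ?_)
  have h2 : H ^ 2 = h ^ (q - 2) * h ^ q := by
    rw [hHdef, ← pow_mul, ← pow_add]; congr 1; omega
  rw [h2]
  exact Ideal.mul_mem_left _ _ hhq
end

section
/- Let n ≥ 10 and let h ∈ ℂ[X₀,…,Xₙ] be an irreducible homogeneous polynomial of degree d defining a totally invariant hypersurface X = {h = 0} ⊂ ℙⁿ(ℂ) whose singular locus has dimension at most 2, i.e. the Jacobian ring J(h) has Krull dimension ≤ 3. Then d = 1, i.e. X is a hyperplane. -/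
open MvPolynomial

section Koszul
variable {R : Type*} [CommRing R] {M : Type*} [AddCommGroup M] [Module R M]

lemma kz_contract_mem (D : Module.Dual R M) (p : ℕ) (x : ExteriorAlgebra R M)
    (hx : x ∈ ⋀[R]^(p+1) M) : CliffordAlgebra.contractLeft (Q := 0) D x ∈ ⋀[R]^p M := by
  induction p generalizing x with
  | zero =>
    rw [ExteriorAlgebra.exteriorPower, zero_add, pow_one] at hx
    obtain ⟨m, rfl⟩ := hx
    erw [CliffordAlgebra.contractLeft_ι]
    rw [ExteriorAlgebra.exteriorPower, pow_zero, Submodule.mem_one]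
    exact ⟨_, rfl⟩
  | succ p ih =>
    have hx' : x ∈ LinearMap.range (ExteriorAlgebra.ι R : M →ₗ[R] _) *
      (LinearMap.range (ExteriorAlgebra.ι R : M →ₗ[R] _)) ^ (p+1) := by
      rw [← pow_succ']; exact hx
    induction hx' using Submodule.mul_induction_on' with
    | mem_mul_mem m hm n hn =>
      obtain ⟨m, rfl⟩ := hm
      erw [CliffordAlgebra.contractLeft_ι_mul]
      refine Submodule.sub_mem _ (Submodule.smul_mem _ _ hn) ?_
      rw [ExteriorAlgebra.exteriorPower, pow_succ']
      exact Submodule.mul_mem_mul ⟨m, rfl⟩ (ih _ hn)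
    | add x hx' y hy' h1 h2 =>
      rw [map_add]
      refine Submodule.add_mem _ (h1 ?_) (h2 ?_)
      · rw [ExteriorAlgebra.exteriorPower, pow_succ']; exact hx'
      · rw [ExteriorAlgebra.exteriorPower, pow_succ']; exact hy'

lemma kz_smul_top_inf (J : Ideal R) (p : ℕ) (x : ExteriorAlgebra R M)
    (hx : x ∈ ⋀[R]^p M) (hJ : x ∈ J • (⊤ : Submodule R (ExteriorAlgebra R M))) :
    x ∈ J • (⋀[R]^p M) := by
  classical
  let P : ExteriorAlgebra R M →ₗ[R] ExteriorAlgebra R M :=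
    GradedAlgebra.proj (fun i : ℕ ↦ ⋀[R]^i M) p
  have h1 : P x = x := by
    simp only [P, GradedAlgebra.proj_apply]
    exact DirectSum.decompose_of_mem_same _ hx
  have h2 : P x ∈ Submodule.map P (J • ⊤) := Submodule.mem_map_of_mem hJ
  rw [Submodule.map_smul'', h1] at h2
  refine Submodule.smul_mono le_rfl ?_ h2
  rintro _ ⟨z, -, rfl⟩
  simp only [P, GradedAlgebra.proj_apply]
  exact SetLike.coe_mem _

lemma kz_main {r : ℕ} (F : Fin r → R) (y : ℕ → R) (γ : ℕ → Fin r → R) (J : ℕ → Ideal R)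
    (t : ℕ) (hJ : ∀ k, J (k+1) = J k ⊔ Ideal.span {y k})
    (hy : ∀ k, y k = ∑ j, F j * γ k j)
    (hreg : ∀ k < t, ∀ a, y k * a ∈ J k → a ∈ J k)
    (m s p : ℕ) (hm : s + m = t) (hp : r < p + m) (f : ExteriorAlgebra R (Fin r → R))
    (hf : f ∈ ⋀[R]^p (Fin r → R))
    (hdf : CliffordAlgebra.contractLeft (Q := 0) (Fintype.linearCombination R F) f ∈
       J s • (⊤ : Submodule R (ExteriorAlgebra R (Fin r → R)))) :
    ∃ w ∈ ⋀[R]^(p+1) (Fin r → R),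
      f - CliffordAlgebra.contractLeft (Q := 0) (Fintype.linearCombination R F) w ∈
       J s • (⊤ : Submodule R (ExteriorAlgebra R (Fin r → R))) := by
  induction m generalizing s p f with
  | zero =>
    refine ⟨0, zero_mem _, ?_⟩
    have he : IsEmpty (Set.powersetCard (Fin r) p) := by
      constructor
      rintro ⟨u, hu⟩
      have := Finset.card_le_univ u
      rw [Set.powersetCard.mem_iff] at hu
      simp at this; omega
    have hs : Subsingleton (⋀[R]^p (Fin r → R)) :=
      ((Pi.basisFun R (Fin r)).exteriorPower (n := p)).repr.toEquiv.subsingleton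
    have : f = 0 := congrArg Subtype.val (Subsingleton.elim (⟨f, hf⟩ : ⋀[R]^p (Fin r → R)) 0)
    rw [this]; simp
  | succ m ih =>
    set D := Fintype.linearCombination R F
    have hD : D (γ s) = y s := by
      simp [D, Fintype.linearCombination_apply, hy, mul_comm]
    have e1 : CliffordAlgebra.contractLeft (Q := 0) D (ExteriorAlgebra.ι R (γ s) * f)
       = y s • f - ExteriorAlgebra.ι R (γ s) * CliffordAlgebra.contractLeft (Q := 0) D f := by
      erw [CliffordAlgebra.contractLeft_ι_mul, hD]
    have hmulJ : ∀ (I : Ideal R) (z u : ExteriorAlgebra R (Fin r → R)),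
        u ∈ I • (⊤ : Submodule R (ExteriorAlgebra R (Fin r → R))) →
        z * u ∈ I • (⊤ : Submodule R (ExteriorAlgebra R (Fin r → R))) := by
      intro I z u hu
      have := Submodule.mem_map_of_mem (f := LinearMap.mulLeft R z) hu
      rw [Submodule.map_smul''] at this
      exact Submodule.smul_mono le_rfl le_top this
    have hle : J s ≤ J (s+1) := by rw [hJ]; exact le_sup_left
    have hym : y s ∈ J (s+1) := by
      rw [hJ]; exact Ideal.mem_sup_right (Ideal.mem_span_singleton_self _)
    have hεf : ExteriorAlgebra.ι R (γ s) * f ∈ ⋀[R]^(p+1) (Fin r → R) := by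
      rw [ExteriorAlgebra.exteriorPower, pow_succ']
      exact Submodule.mul_mem_mul ⟨_, rfl⟩ hf
    obtain ⟨w, hw, hw2⟩ := ih (s+1) (p+1) (by omega) (by omega) (ExteriorAlgebra.ι R (γ s) * f) hεf
      (by
        rw [e1]
        refine Submodule.sub_mem _ (Submodule.smul_mem_smul hym trivial) ?_
        exact Submodule.smul_mono_left hle (hmulJ _ _ _ hdf))
    have h3 := kz_smul_top_inf (J (s+1)) (p+1) _
      (Submodule.sub_mem _ hεf (kz_contract_mem D (p+1) w hw)) hw2
    rw [hJ, Submodule.sup_smul, Submodule.mem_sup] at h3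
    obtain ⟨j, hj, w', hw', hsum⟩ := h3
    rw [Submodule.ideal_span_singleton_smul] at hw'
    obtain ⟨w', hw'', rfl⟩ := hw'
    refine ⟨w', hw'', ?_⟩
    have h5 : y s • (f - CliffordAlgebra.contractLeft (Q := 0) D w') ∈
        J s • (⊤ : Submodule R (ExteriorAlgebra R (Fin r → R))) := by
      have h6 : CliffordAlgebra.contractLeft (Q := 0) D (ExteriorAlgebra.ι R (γ s) * f) =
         CliffordAlgebra.contractLeft (Q := 0) D j + y s • CliffordAlgebra.contractLeft (Q := 0) D w' := by
        have := congrArg (CliffordAlgebra.contractLeft (Q := 0) D) hsum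
        rw [map_sub, map_add, CliffordAlgebra.contractLeft_contractLeft, sub_zero] at this
        rw [← this]
        congr 1
        exact map_smul _ _ _
      have h7 : y s • (f - CliffordAlgebra.contractLeft (Q := 0) D w') =
          CliffordAlgebra.contractLeft (Q := 0) D j + ExteriorAlgebra.ι R (γ s) * CliffordAlgebra.contractLeft (Q := 0) D f := by
        rw [e1] at h6
        rw [smul_sub, sub_eq_iff_eq_add, sub_eq_iff_eq_add.1 h6]
        abel
      rw [h7]
      refine Submodule.add_mem _ ?_ (hmulJ _ _ _ hdf)
      have := Submodule.mem_map_of_mem (f := CliffordAlgebra.contractLeft (Q := 0) D) hj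
      rw [Submodule.map_smul''] at this
      exact Submodule.smul_mono le_rfl le_top this
    set B := (Pi.basisFun R (Fin r)).ExteriorAlgebra
    have key : ∀ u : ExteriorAlgebra R (Fin r → R), u ∈ J s • (⊤ : Submodule R (ExteriorAlgebra R (Fin r → R)))
        ↔ ∀ i, B.repr u i ∈ J s := by
      intro u
      constructor
      · intro hu i
        have := Submodule.mem_map_of_mem (f := B.coord i) hu
        rw [Submodule.map_smul''] at this
        have h2 := Submodule.smul_mono (le_refl (J s)) le_top this
        simpa using h2
      · intro hu
        rw [← B.sum_repr u]
        exact Submodule.sum_mem _ fun i _ => Submodule.smul_mem_smul (hu i) trivial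
    rw [key] at h5 ⊢
    intro i
    refine hreg s (by omega) _ ?_
    have := h5 i
    rwa [map_smul, Finsupp.smul_apply, smul_eq_mul] at this

lemma kz_two {r : ℕ} (F : Fin r → R) (w : ExteriorAlgebra R (Fin r → R))
    (hw : w ∈ ⋀[R]^2 (Fin r → R)) : ∃ c : Fin r → Fin r → R, (∀ j l, c j l = - c l j) ∧
      CliffordAlgebra.contractLeft (Q := 0) (Fintype.linearCombination R F) w =
      ExteriorAlgebra.ι R (fun j => ∑ l, c j l * F l) := by
  rw [ExteriorAlgebra.exteriorPower, pow_two] at hw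
  induction hw using Submodule.mul_induction_on' with
  | mem_mul_mem m hm n hn =>
    obtain ⟨a, rfl⟩ := hm
    obtain ⟨b, rfl⟩ := hn
    refine ⟨fun j l => a l * b j - b l * a j, fun j l => by ring, ?_⟩
    have : CliffordAlgebra.contractLeft (Q := 0) (Fintype.linearCombination R F)
      (ExteriorAlgebra.ι R b) = algebraMap R _ (Fintype.linearCombination R F b) :=
      CliffordAlgebra.contractLeft_ι _ _ _
    erw [CliffordAlgebra.contractLeft_ι_mul, this]
    rw [← Algebra.commutes, ← Algebra.smul_def]
    erw [← map_smul, ← map_smul, ← map_sub]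
    congr 1
    ext j
    simp only [Fintype.linearCombination_apply, Pi.sub_apply, Pi.smul_apply, smul_eq_mul,
      Finset.sum_mul, ← Finset.sum_sub_distrib]
    refine Finset.sum_congr rfl fun l _ => by ring
  | add x hx y hy h1 h2 =>
    obtain ⟨c, hc, h1⟩ := h1
    obtain ⟨c', hc', h2⟩ := h2
    refine ⟨c + c', fun j l => by simp [hc j l, hc' j l]; ring, ?_⟩
    rw [map_add, h1, h2, ← map_add]
    congr 1
    ext j
    simp [add_mul, Finset.sum_add_distrib]

lemma kz_H1 {r : ℕ} (F : Fin r → R) (y : ℕ → R) (γ : ℕ → Fin r → R) (J : ℕ → Ideal R)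
    (hJ0 : J 0 = ⊥) (hJ : ∀ k, J (k+1) = J k ⊔ Ideal.span {y k})
    (hy : ∀ k, y k = ∑ j, F j * γ k j)
    (hreg : ∀ k < r, ∀ a, y k * a ∈ J k → a ∈ J k)
    (b : Fin r → R) (hb : ∑ j, b j * F j = 0) :
    ∃ c : Fin r → Fin r → R, (∀ j l, c j l = - c l j) ∧ ∀ j, b j = ∑ l, c j l * F l := by
  obtain ⟨w, hw, h⟩ := kz_main F y γ J r hJ hy hreg r 0 1 (by omega) (by omega)
    (ExteriorAlgebra.ι R b) (by rw [ExteriorAlgebra.exteriorPower, pow_one]; exact ⟨_, rfl⟩) (by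
      have : CliffordAlgebra.contractLeft (Q := 0) (Fintype.linearCombination R F)
        (ExteriorAlgebra.ι R b) = algebraMap R _ (Fintype.linearCombination R F b) :=
        CliffordAlgebra.contractLeft_ι _ _ _
      rw [this, Fintype.linearCombination_apply]
      simp [hb])
  obtain ⟨c, hc, h2⟩ := kz_two F w hw
  refine ⟨c, hc, ?_⟩
  rw [hJ0, Submodule.bot_smul, Submodule.mem_bot, h2, sub_eq_zero] at h
  have := (ExteriorAlgebra.ι_leftInverse (R := R) (M := Fin r → R)).injective h
  exact fun j => congrFun this j
end Koszul

section Nul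
variable {r q : ℕ} {F : Fin r → MvPolynomial (Fin r) ℂ}

lemma endo_pow (hF : IsEndo r q F) : ∃ N : ℕ, 0 < N ∧ ∀ i, (X i : MvPolynomial (Fin r) ℂ) ^ N ∈ Ideal.span (Set.range F) := by
  have h : ∀ i, ∃ N : ℕ, (X i : MvPolynomial (Fin r) ℂ) ^ N ∈ Ideal.span (Set.range F) := by
    intro i
    change X i ∈ (Ideal.span (Set.range F)).radical
    rw [← MvPolynomial.vanishingIdeal_zeroLocus_eq_radical (K := ℂ)]
    rw [mem_vanishingIdeal_iff]
    intro x hx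
    rw [mem_zeroLocus_iff] at hx
    have : x = 0 := hF.2 x fun j => by
      simpa using hx (F j) (Ideal.subset_span ⟨j, rfl⟩)
    simp [this]
  choose N hN using h
  refine ⟨∑ i, N i + 1, by omega, fun i => ?_⟩
  refine Ideal.pow_mem_of_pow_mem _ (hN i) ?_
  have := Finset.single_le_sum (f := N) (fun _ _ => Nat.zero_le _) (Finset.mem_univ i)
  omega

lemma mono_reg (N k : ℕ) (hk : k < r) (a : MvPolynomial (Fin r) ℂ)
    (h : X (⟨k, hk⟩ : Fin r) ^ N * a ∈ Ideal.span ((fun s => monomial s (1:ℂ)) ''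
      {s | ∃ i : Fin r, i.1 < k ∧ s = Finsupp.single i N})) :
    a ∈ Ideal.span ((fun s => monomial s (1:ℂ)) ''
      {s | ∃ i : Fin r, i.1 < k ∧ s = Finsupp.single i N}) := by
  rw [mem_ideal_span_monomial_image] at h ⊢
  intro α hα
  have h2 : Finsupp.single (⟨k, hk⟩ : Fin r) N + α ∈ (X (⟨k, hk⟩ : Fin r) ^ N * a).support := by
    rw [mem_support_iff, X_pow_eq_monomial, coeff_monomial_mul, one_mul]
    exact mem_support_iff.1 hα
  obtain ⟨s, ⟨i, hi, rfl⟩, hs⟩ := h _ h2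
  refine ⟨_, ⟨i, hi, rfl⟩, ?_⟩
  rw [Finsupp.single_le_iff] at hs ⊢
  rw [Finsupp.add_apply, Finsupp.single_eq_of_ne, zero_add] at hs
  · exact hs
  · rintro rfl; simp at hi

lemma endo_H1 (hF : IsEndo r q F) (b : Fin r → MvPolynomial (Fin r) ℂ)
    (hb : ∑ j, b j * F j = 0) :
    ∃ c : Fin r → Fin r → MvPolynomial (Fin r) ℂ,
     (∀ j l, c j l = - c l j) ∧ ∀ j, b j = ∑ l, c j l * F l := by
  obtain ⟨N, hN0, hN⟩ := endo_pow hF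
  have h1 : ∀ i, ∃ γ : Fin r → MvPolynomial (Fin r) ℂ, X i ^ N = ∑ j, F j * γ j := by
    intro i
    obtain ⟨c, hc⟩ := (Ideal.mem_span_range_iff_exists_fun).1 (hN i)
    exact ⟨c, by rw [← hc]; exact Finset.sum_congr rfl fun _ _ => mul_comm _ _⟩
  choose γ hγ using h1
  refine kz_H1 F (fun k => if h : k < r then X ⟨k, h⟩ ^ N else 0)
    (fun k => if h : k < r then γ ⟨k, h⟩ else 0)
    (fun k => Ideal.span ((fun s => monomial s (1:ℂ)) ''
      {s | ∃ i : Fin r, i.1 < k ∧ s = Finsupp.single i N})) ?_ ?_ ?_ ?_ b hb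
  · simp
  · intro k
    rw [← Ideal.span_union]
    split_ifs with h
    · congr 1
      ext z
      simp only [Set.mem_image, Set.mem_ofPred_eq, Set.mem_union, Set.mem_singleton_iff]
      constructor
      · rintro ⟨s, ⟨i, hi, rfl⟩, rfl⟩
        rcases Nat.lt_succ_iff_lt_or_eq.1 hi with hi | hi
        · exact Or.inl ⟨_, ⟨i, hi, rfl⟩, rfl⟩
        · right; rw [X_pow_eq_monomial]; congr; exact Fin.ext hi
      · rintro (⟨s, ⟨i, hi, rfl⟩, rfl⟩ | rfl)
        · exact ⟨_, ⟨i, by omega, rfl⟩, rfl⟩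
        · exact ⟨_, ⟨⟨k, h⟩, by simp, rfl⟩, by rw [X_pow_eq_monomial]⟩
    · have : {s : Fin r →₀ ℕ | ∃ i : Fin r, i.1 < k+1 ∧ s = Finsupp.single i N} =
         {s | ∃ i : Fin r, i.1 < k ∧ s = Finsupp.single i N} := by
        ext s
        constructor
        · rintro ⟨i, -, rfl⟩; exact ⟨i, by omega, rfl⟩
        · rintro ⟨i, -, rfl⟩; exact ⟨i, by omega, rfl⟩
      rw [this, Ideal.span_union]; simp
  · intro k
    split_ifs with h
    · exact hγ _
    · simp
  · intro k hk a ha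
    rw [dif_pos hk] at ha
    exact mono_reg N k hk a ha
end Nul

section Free
variable {r q : ℕ} {F : Fin r → MvPolynomial (Fin r) ℂ}

lemma hc_mul {σ : Type*} {F b : MvPolynomial σ ℂ} {q : ℕ} (hF : F.IsHomogeneous q) (e : ℕ) :
    homogeneousComponent e (F * b) = if q ≤ e then F * homogeneousComponent (e - q) b else 0 := by
  classical
  conv_lhs => rw [← sum_homogeneousComponent b]
  rw [Finset.mul_sum, map_sum]
  have h1 : ∀ i, homogeneousComponent e (F * homogeneousComponent i b) =
      if q + i = e then F * homogeneousComponent i b else 0 := by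
    intro i
    rw [homogeneousComponent_of_mem (m := e) (n := q + i)]
    · simp only [eq_comm]
    · exact hF.mul (homogeneousComponent_isHomogeneous i b)
  simp only [h1]
  split_ifs with h
  · rw [Finset.sum_eq_single (e - q)]
    · rw [if_pos (by omega)]
    · intro i _ hi
      rw [if_neg (by omega)]
    · intro hi
      rw [if_pos (by omega), homogeneousComponent_eq_zero, mul_zero]
      simp at hi; omega
  · exact Finset.sum_eq_zero fun i _ => if_neg (by omega)

noncomputable def Phi (F : Fin r → MvPolynomial (Fin r) ℂ) (s : Finset (Fin r →₀ ℕ))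
    (p : (Fin r →₀ ℕ) → MvPolynomial (Fin r) ℂ) : MvPolynomial (Fin r) ℂ :=
  ∑ β ∈ s, monomial β 1 * aeval F (p β)

lemma Phi_add (s : Finset (Fin r →₀ ℕ)) (p p') : Phi F s (p + p') = Phi F s p + Phi F s p' := by
  simp [Phi, mul_add, Finset.sum_add_distrib]

lemma Phi_sub (s : Finset (Fin r →₀ ℕ)) (p p') : Phi F s (p - p') = Phi F s p - Phi F s p' := by
  simp [Phi, mul_sub, Finset.sum_sub_distrib]

lemma Phi_mul (s : Finset (Fin r →₀ ℕ)) (a p) :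
    Phi F s (fun β => a * p β) = aeval F a * Phi F s p := by
  simp [Phi, Finset.mul_sum, mul_left_comm]

lemma Phi_sum {ι : Type*} (T : Finset ι) (s : Finset (Fin r →₀ ℕ)) (p : ι → (Fin r →₀ ℕ) → MvPolynomial (Fin r) ℂ) :
    Phi F s (fun β => ∑ i ∈ T, p i β) = ∑ i ∈ T, Phi F s (p i) := by
  simp only [Phi, map_sum, Finset.mul_sum]
  rw [Finset.sum_comm]

lemma endo_basis (hF : IsEndo r q F) (hq : 0 < q) : ∃ s : Finset (Fin r →₀ ℕ), 0 ∈ s ∧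
    (∀ u : MvPolynomial (Fin r) ℂ, ∃ c : (Fin r →₀ ℕ) → ℂ,
      u - ∑ β ∈ s, monomial β (c β) ∈ Ideal.span (Set.range F)) ∧
    (∀ c : (Fin r →₀ ℕ) → ℂ, ∑ β ∈ s, monomial β (c β) ∈ Ideal.span (Set.range F) →
      ∀ β ∈ s, c β = 0) := by
  classical
  obtain ⟨N, hN0, hN⟩ := endo_pow hF
  set I := Ideal.span (Set.range F)
  let π : MvPolynomial (Fin r) ℂ →ₗ[ℂ] (MvPolynomial (Fin r) ℂ ⧸ I) := (Ideal.Quotient.mkₐ ℂ I).toLinearMap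
  have hπ : ∀ u, π u = 0 ↔ u ∈ I := fun u => Ideal.Quotient.eq_zero_iff_mem
  let v : (Fin r →₀ ℕ) → (MvPolynomial (Fin r) ℂ ⧸ I) := fun α => π (monomial α 1)
  let t : Set (Fin r →₀ ℕ) := {α | ∀ i, α i < N}
  have ht : t.Finite := by
    refine Set.Finite.subset (Set.finite_Iic (Finsupp.equivFunOnFinite.symm (fun _ => N))) ?_
    intro α hα i
    exact (hα i).le
  have hvt : ∀ α, v α ∈ Submodule.span ℂ (v '' t) := by
    intro α
    by_cases hα : α ∈ t
    · exact Submodule.subset_span ⟨α, hα, rfl⟩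
    · have : ∃ i, N ≤ α i := by
        by_contra hcon
        push Not at hcon
        exact hα hcon
      obtain ⟨i, hi⟩ := this
      have : v α = 0 := by
        rw [hπ]
        have h3 : monomial α (1:ℂ) = X i ^ N * monomial (α - Finsupp.single i N) 1 := by
          rw [X_pow_eq_monomial, monomial_mul, one_mul, add_tsub_cancel_of_le]
          simpa using hi
        rw [h3]
        exact Ideal.mul_mem_right _ _ (hN i)
      rw [this]; exact zero_mem _
  have h0 : LinearIndepOn ℂ v {0} := by
    rw [linearIndepOn_singleton_iff]
    intro h0
    rw [hπ] at h0
    have : ∀ u ∈ I, constantCoeff u = 0 := by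
      intro u hu
      have hle : I ≤ RingHom.ker (constantCoeff : MvPolynomial (Fin r) ℂ →+* ℂ) := by
        rw [Ideal.span_le]
        rintro _ ⟨j, rfl⟩
        rw [SetLike.mem_coe, RingHom.mem_ker, constantCoeff_eq]
        exact (hF.1 j).coeff_eq_zero (by simpa using hq.ne)
      exact hle hu
    simpa using this _ h0
  obtain ⟨b, hbt, hb0, hspan, hli⟩ := exists_linearIndepOn_extension h0 (t := t) (by
    rintro _ rfl i; simpa using hN0)
  have hbf := ht.subset hbt
  refine ⟨hbf.toFinset, by simpa using hb0, ?_, ?_⟩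
  · intro u
    have : π u ∈ Submodule.span ℂ (v '' b) := by
      rw [u.as_sum, map_sum]
      refine Submodule.sum_mem _ fun α _ => ?_
      have h2 := hvt α
      have h3 := Submodule.span_le.2 hspan h2
      have h4 : π (monomial α (coeff α u)) = coeff α u • v α := by
        rw [← map_smul, smul_monomial, smul_eq_mul, mul_one]
      rw [h4]
      exact Submodule.smul_mem _ _ h3
    rw [← hbf.coe_toFinset, Submodule.mem_span_image_finset_iff_exists_fun] at this
    obtain ⟨c, hc⟩ := this
    refine ⟨fun β => if h : β ∈ hbf.toFinset then c ⟨β, h⟩ else 0, ?_⟩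
    rw [← hπ, map_sub, ← hc, map_sum, sub_eq_zero]
    rw [← Finset.sum_coe_sort hbf.toFinset]
    refine Finset.sum_congr rfl fun α _ => ?_
    beta_reduce
    rw [dif_pos α.2]
    rw [← map_smul, smul_monomial, smul_eq_mul, mul_one]
  · intro c hc
    rw [← hπ, map_sum] at hc
    rw [← hbf.coe_toFinset, linearIndepOn_finset_iff] at hli
    refine hli c ?_
    rw [← hc]
    refine Finset.sum_congr rfl fun α _ => ?_
    rw [← map_smul, smul_monomial, smul_eq_mul, mul_one]
lemma Phi_surj {s : Finset (Fin r →₀ ℕ)} (hF : IsEndo r q F) (hq : 0 < q)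
    (h1 : ∀ u : MvPolynomial (Fin r) ℂ, ∃ c : (Fin r →₀ ℕ) → ℂ,
      u - ∑ β ∈ s, monomial β (c β) ∈ Ideal.span (Set.range F))
    (u : MvPolynomial (Fin r) ℂ) : ∃ p, Phi F s p = u := by
  classical
  have key : ∀ e, ∀ u : MvPolynomial (Fin r) ℂ, u.IsHomogeneous e → ∃ p, Phi F s p = u := by
    intro e
    induction e using Nat.strong_induction_on with
    | _ e ih =>
    intro u hu
    obtain ⟨c, hc⟩ := h1 u
    obtain ⟨b, hb⟩ := (Ideal.mem_span_range_iff_exists_fun).1 hc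
    have h2 : u = ∑ β ∈ s, homogeneousComponent e (monomial β (c β)) +
        ∑ j, homogeneousComponent e (F j * b j) := by
      have h3 : u = ∑ β ∈ s, (monomial β (c β)) + ∑ j, (F j * b j) := by
        simp only [mul_comm (F _)]
        rw [hb]; ring
      conv_lhs => rw [← homogeneousComponent_eq_self hu, h3]
      simp only [map_add, map_sum]
    have h4 : ∀ j, ∃ p, Phi F s p = homogeneousComponent e (F j * b j) := by
      intro j
      rw [hc_mul (hF.1 j)]
      split_ifs with h
      · obtain ⟨p, hp⟩ := ih (e - q) (by omega) _ (homogeneousComponent_isHomogeneous (e - q) (b j))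
        refine ⟨fun β => X j * p β, ?_⟩
        rw [Phi_mul, hp, aeval_X]
      · exact ⟨0, by simp [Phi]⟩
    choose p hp using h4
    refine ⟨(fun β => if β.degree = e then C (c β) else 0) + fun β => ∑ j, p j β, ?_⟩
    rw [Phi_add, Phi_sum, h2]
    congr 1
    · refine Finset.sum_congr rfl fun β _ => ?_
      rw [homogeneousComponent_of_mem (n := β.degree)]
      · simp only [eq_comm (a := e)]
        split_ifs
        · simp [monomial_eq]; ring
        · simp
      · exact isHomogeneous_monomial _ rfl
    · exact Finset.sum_congr rfl fun j _ => hp j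
  have h5 : ∀ i, ∃ p, Phi F s p = homogeneousComponent i u := fun i =>
    key i _ (homogeneousComponent_isHomogeneous i u)
  choose p hp using h5
  refine ⟨fun β => ∑ i ∈ Finset.range (u.totalDegree + 1), p i β, ?_⟩
  rw [Phi_sum]
  simp only [hp, sum_homogeneousComponent]

lemma sum_antisymm (c : Fin r → Fin r → MvPolynomial (Fin r) ℂ) (hc : ∀ j l, c j l = - c l j)
    (y : Fin r → MvPolynomial (Fin r) ℂ) : ∑ j, y j * ∑ l, y l * c j l = 0 := by
  have : ∑ j, y j * ∑ l, y l * c j l = - ∑ j, y j * ∑ l, y l * c j l := by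
    conv_rhs => simp only [Finset.mul_sum]
    rw [Finset.sum_comm]
    simp only [Finset.mul_sum, ← Finset.sum_neg_distrib]
    refine Finset.sum_congr rfl fun j _ => Finset.sum_congr rfl fun l _ => ?_
    rw [hc l j]; ring
  exact self_eq_neg.1 this

lemma Phi_inj {s : Finset (Fin r →₀ ℕ)} (hF : IsEndo r q F) (hq : 0 < q)
    (h1 : ∀ u : MvPolynomial (Fin r) ℂ, ∃ c : (Fin r →₀ ℕ) → ℂ,
      u - ∑ β ∈ s, monomial β (c β) ∈ Ideal.span (Set.range F))
    (h2 : ∀ c : (Fin r →₀ ℕ) → ℂ, ∑ β ∈ s, monomial β (c β) ∈ Ideal.span (Set.range F) →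
      ∀ β ∈ s, c β = 0)
    (p) (hp : Phi F s p = 0) : ∀ β ∈ s, p β = 0 := by
  classical
  have key : ∀ m : ℕ, ∀ p, Phi F s p = 0 → ∀ β ∈ s, p β ∈ (idealOfVars (Fin r) ℂ) ^ m := by
    intro m
    induction m with
    | zero => intro p _ β _; simp
    | succ m ih =>
      intro p hp
      -- constant coefficients vanish
      have hX : ∀ u : MvPolynomial (Fin r) ℂ, u - C (constantCoeff u) ∈ idealOfVars (Fin r) ℂ := by
        intro u
        rw [← pow_one (idealOfVars (Fin r) ℂ), mem_pow_idealOfVars_iff']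
        intro x hx
        have : x = 0 := by rwa [Nat.lt_one_iff, Finsupp.degree_eq_zero_iff] at hx
        subst this
        simp [constantCoeff_eq]
      have hmapX : ∀ u ∈ idealOfVars (Fin r) ℂ, aeval F u ∈ Ideal.span (Set.range F) := by
        intro u hu
        have hle : idealOfVars (Fin r) ℂ ≤ (Ideal.span (Set.range F)).comap (aeval F).toRingHom := by
          rw [idealOfVars, Ideal.span_le]
          rintro _ ⟨j, rfl⟩
          simp only [SetLike.mem_coe, Ideal.mem_comap]
          have : (aeval F).toRingHom (X j : MvPolynomial (Fin r) ℂ) = F j := by simp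
          rw [this]
          exact Ideal.subset_span ⟨j, rfl⟩
        exact hle hu
      have hc0 : ∀ β ∈ s, constantCoeff (p β) = 0 := by
        apply h2
        have h3 : ∑ β ∈ s, monomial β (constantCoeff (p β)) =
          - ∑ β ∈ s, monomial β 1 * aeval F (p β - C (constantCoeff (p β))) := by
          rw [eq_neg_iff_add_eq_zero, ← hp, Phi, ← Finset.sum_add_distrib]
          refine Finset.sum_congr rfl fun β _ => ?_
          have : monomial β (constantCoeff (p β)) = monomial β 1 * C (constantCoeff (p β)) := by
            rw [mul_comm, C_mul_monomial, mul_one]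
          rw [this]
          simp only [map_sub, algHom_C, algebraMap_eq]
          ring
        rw [h3]
        refine Submodule.neg_mem _ (Submodule.sum_mem _ fun β _ => Ideal.mul_mem_left _ _ (hmapX _ (hX _)))
      have hpj : ∀ β, ∃ pj : Fin r → MvPolynomial (Fin r) ℂ, β ∈ s → p β = ∑ j, X j * pj j := by
        intro β
        by_cases hβ : β ∈ s
        · have := hX (p β)
          rw [hc0 β hβ, map_zero, sub_zero] at this
          obtain ⟨c, hc⟩ := (Ideal.mem_span_range_iff_exists_fun).1 this
          exact ⟨c, fun _ => by rw [← hc]; exact Finset.sum_congr rfl fun _ _ => mul_comm _ _⟩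
        · exact ⟨0, fun h => absurd h hβ⟩
      choose pj hpj using hpj
      have h5 : ∑ j, Phi F s (fun β => pj β j) * F j = 0 := by
        rw [← hp]
        have : Phi F s p = Phi F s (fun β => ∑ j, X j * pj β j) := by
          refine Finset.sum_congr rfl fun β hβ => ?_
          rw [hpj β hβ]
        rw [this, Phi_sum]
        refine Finset.sum_congr rfl fun j _ => ?_
        rw [Phi_mul, aeval_X, mul_comm]
      obtain ⟨c, hc, hcF⟩ := endo_H1 hF _ h5
      have h6 : ∀ j l, ∃ P, Phi F s P = c j l := fun j l => Phi_surj hF hq h1 _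
      choose P hP using h6
      let Cc : Fin r → Fin r → (Fin r →₀ ℕ) → MvPolynomial (Fin r) ℂ :=
        fun j l β => C (1/2) * (P j l β - P l j β)
      have hCc : ∀ j l, Phi F s (Cc j l) = c j l := by
        intro j l
        have : Cc j l = fun β => C (1/2) * ((P j l - P l j) β) := rfl
        rw [this, Phi_mul, Phi_sub, hP, hP, hc l j, algHom_C, algebraMap_eq]
        have : (C (1/2) : MvPolynomial (Fin r) ℂ) * 2 = 1 := by
          rw [show (2 : MvPolynomial (Fin r) ℂ) = C 2 from (map_ofNat C 2).symm, ← C_mul]; norm_num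
        linear_combination c j l * this
      have hanti : ∀ β j l, Cc j l β = - Cc l j β := by intro β j l; change C (1/2) * (P j l β - P l j β) = -(C (1/2) * (P l j β - P j l β)); ring
      intro β hβ
      have h7 : p β = ∑ j, X j * (pj β j - ∑ l, X l * Cc j l β) := by
        simp only [mul_sub, Finset.sum_sub_distrib]
        rw [sum_antisymm (fun j l => Cc j l β) (hanti β), sub_zero, hpj β hβ]
      rw [h7]
      refine Submodule.sum_mem _ fun j _ => ?_
      rw [pow_succ']
      refine Ideal.mul_mem_mul (Ideal.subset_span ⟨j, rfl⟩) ?_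
      refine ih (fun β => pj β j - ∑ l, X l * Cc j l β) ?_ β hβ
      have : (fun β => pj β j - ∑ l, X l * Cc j l β) = (fun β => pj β j) - fun β => ∑ l, X l * Cc j l β := rfl
      rw [this, Phi_sub, hcF j, Phi_sum, sub_eq_zero]
      refine Finset.sum_congr rfl fun l _ => ?_
      rw [Phi_mul, hCc, aeval_X, mul_comm]
  intro β hβ
  ext α
  have := key (α.degree + 1) p hp β hβ
  rw [mem_pow_idealOfVars_iff'] at this
  rw [this α (by omega), coeff_zero]

theorem endo_free (hF : IsEndo r q F) (hq : 0 < q) : ∃ s : Finset (Fin r →₀ ℕ), 0 ∈ s ∧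
    (∀ u, ∃ p, Phi F s p = u) ∧ (∀ p, Phi F s p = 0 → ∀ β ∈ s, p β = 0) := by
  obtain ⟨s, h0, h1, h2⟩ := endo_basis hF hq
  exact ⟨s, h0, Phi_surj hF hq h1, Phi_inj hF hq h1 h2⟩
end Free

section Rho
variable {r q : ℕ} {F : Fin r → MvPolynomial (Fin r) ℂ} {s : Finset (Fin r →₀ ℕ)}

structure FreeData (q : ℕ) (F : Fin r → MvPolynomial (Fin r) ℂ) (s : Finset (Fin r →₀ ℕ)) : Prop where
  endo : IsEndo r q F
  hq : 2 ≤ q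
  zero_mem : 0 ∈ s
  surj : ∀ u, ∃ p, Phi F s p = u
  inj : ∀ p, Phi F s p = 0 → ∀ β ∈ s, p β = 0

noncomputable def rho (H : FreeData q F s) (β : Fin r →₀ ℕ) (u : MvPolynomial (Fin r) ℂ) :
    MvPolynomial (Fin r) ℂ := Classical.choose (H.surj u) β

variable (H : FreeData q F s)

include H in
lemma phi_hc (e : ℕ) (a : MvPolynomial (Fin r) ℂ) :
    homogeneousComponent e (aeval F a) = if q ∣ e then aeval F (homogeneousComponent (e / q) a) else 0 := by
  classical
  have hq := H.hq
  conv_lhs => rw [← sum_homogeneousComponent a]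
  rw [map_sum, map_sum]
  have h1 : ∀ i, homogeneousComponent e (aeval F (homogeneousComponent i a)) =
      if q * i = e then aeval F (homogeneousComponent i a) else 0 := by
    intro i
    rw [homogeneousComponent_of_mem (m := e) (n := q * i)]
    · simp only [eq_comm]
    · exact (homogeneousComponent_isHomogeneous i a).aeval F H.endo.1
  simp only [h1]
  split_ifs with h
  · obtain ⟨k, rfl⟩ := h
    rw [Nat.mul_div_cancel_left _ (by omega)]
    rw [Finset.sum_eq_single k]
    · rw [if_pos rfl]
    · intro i _ hi
      rw [if_neg]
      intro h; exact hi (Nat.eq_of_mul_eq_mul_left (by omega) h)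
    · intro hi
      rw [if_pos rfl, homogeneousComponent_eq_zero, map_zero]
      simp at hi; omega
  · exact Finset.sum_eq_zero fun i _ => if_neg (by rintro rfl; exact h ⟨_, rfl⟩)

lemma rho_spec (u) : ∑ β ∈ s, monomial β 1 * aeval F (rho H β u) = u := Classical.choose_spec (H.surj u)

lemma rho_unique {u p} (hp : Phi F s p = u) {β} (hβ : β ∈ s) : rho H β u = p β := by
  have := H.inj (p - fun β => rho H β u) (by
    rw [Phi_sub, hp, sub_eq_zero]; exact (rho_spec H u).symm) β hβ
  simp only [Pi.sub_apply, sub_eq_zero] at this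
  exact this.symm

lemma rho_add {β} (hβ : β ∈ s) (u v) : rho H β (u + v) = rho H β u + rho H β v :=
  rho_unique H (p := (fun β => rho H β u) + fun β => rho H β v) (by
    rw [Phi_add]; exact congrArg₂ _ (rho_spec H u) (rho_spec H v)) hβ

lemma rho_mul {β} (hβ : β ∈ s) (a u) : rho H β (aeval F a * u) = a * rho H β u :=
  rho_unique H (p := (fun β => a * rho H β u)) (by
    rw [Phi_mul]; exact congrArg _ (rho_spec H u)) hβ

lemma rho_sum {ι : Type*} (T : Finset ι) {β} (hβ : β ∈ s) (u : ι → MvPolynomial (Fin r) ℂ) :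
    rho H β (∑ i ∈ T, u i) = ∑ i ∈ T, rho H β (u i) :=
  rho_unique H (p := (fun β => ∑ i ∈ T, rho H β (u i))) (by
    rw [Phi_sum]; exact Finset.sum_congr rfl fun i _ => rho_spec H _) hβ

lemma rho_C_mul {β} (hβ : β ∈ s) (c : ℂ) (u) : rho H β (C c * u) = C c * rho H β u := by
  have := rho_mul H hβ (C c) u
  rwa [algHom_C, algebraMap_eq] at this

lemma rho_zero {β} (hβ : β ∈ s) : rho H β 0 = 0 := by
  have := rho_C_mul H hβ 0 0
  simpa using this

include H in
lemma phi_inj {a b : MvPolynomial (Fin r) ℂ} (h : aeval F a = aeval F b) : a = b := by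
  have h1 : ∀ c : MvPolynomial (Fin r) ℂ, aeval F c = aeval F c * 1 := by intro c; rw [mul_one]
  classical
  have h2 : rho H 0 1 = 1 := rho_unique H (p := fun β => if β = 0 then 1 else 0) (by
    rw [Phi, Finset.sum_eq_single 0]
    · simp
    · intro β _ hb; simp [hb]
    · intro h; exact absurd H.zero_mem h) H.zero_mem
  have := rho_mul H H.zero_mem a 1
  rw [← h1, h, h1, rho_mul H H.zero_mem, h2] at this
  simpa using this.symm

lemma rho_hc {β} (hβ : β ∈ s) (e : ℕ) (u) (hu : u.IsHomogeneous e) :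
    rho H β u = if β.degree ≤ e then if q ∣ e - β.degree then
       homogeneousComponent ((e - β.degree) / q) (rho H β u) else 0 else 0 := by
  refine rho_unique H (p := fun β => if β.degree ≤ e then if q ∣ e - β.degree then
       homogeneousComponent ((e - β.degree) / q) (rho H β u) else 0 else 0) ?_ hβ
  conv_rhs => rw [← homogeneousComponent_eq_self hu, ← rho_spec H u]
  rw [map_sum]
  refine Finset.sum_congr rfl fun β _ => ?_
  rw [hc_mul (isHomogeneous_monomial 1 rfl), phi_hc H]
  beta_reduce
  split_ifs <;> simp

lemma rho_hom {β} (hβ : β ∈ s) {e j : ℕ} {u} (hu : u.IsHomogeneous e) (hj : q * j + β.degree = e) :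
    (rho H β u).IsHomogeneous j := by
  have hq := H.hq
  rw [rho_hc H hβ e u hu, if_pos (by omega)]
  have : e - β.degree = q * j := by omega
  rw [if_pos ⟨j, this⟩, this, Nat.mul_div_cancel_left _ (by omega)]
  exact homogeneousComponent_isHomogeneous _ _

lemma rho_hom_zero {β} (hβ : β ∈ s) {e : ℕ} {u} (hu : u.IsHomogeneous e) (hj : ∀ j, q * j + β.degree ≠ e) :
    rho H β u = 0 := by
  rw [rho_hc H hβ e u hu]
  split_ifs with h1 h2
  · obtain ⟨j, h2⟩ := h2
    exact absurd (by omega) (hj j)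
  · rfl
  · rfl

lemma finite_of_span {S T ι : Type*} [CommRing S] [CommRing T] (f : S →+* T) (s : Finset ι)
    (t : ι → T) (h : ∀ u, ∃ p : ι → S, ∑ β ∈ s, t β * f (p β) = u) : f.Finite := by
  classical
  let _ := f.toAlgebra
  refine ⟨⟨s.image t, ?_⟩⟩
  rw [eq_top_iff]
  intro u _
  obtain ⟨p, rfl⟩ := h u
  refine Submodule.sum_mem _ fun β hβ => ?_
  have : t β * f (p β) = (p β) • t β := by
    rw [mul_comm]; rfl
  rw [this]
  refine Submodule.smul_mem _ _ (Submodule.subset_span ?_)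
  simp only [Finset.coe_image]
  exact ⟨β, hβ, rfl⟩

include H in
lemma phi_integral (a : MvPolynomial (Fin r) ℂ) :
    ∃ p : Polynomial (MvPolynomial (Fin r) ℂ), p.Monic ∧ p.eval₂ (aeval F).toRingHom a = 0 :=
  (finite_of_span (aeval F : MvPolynomial (Fin r) ℂ →ₐ[ℂ] MvPolynomial (Fin r) ℂ).toRingHom s
    (fun β => monomial β 1) H.surj).to_isIntegral a

include H in
lemma der_zero (D : Derivation ℂ (MvPolynomial (Fin r) ℂ) (MvPolynomial (Fin r) ℂ))
    (hD : ∀ i, D (F i) = 0) : D = 0 := by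
  have hφ : ∀ a : MvPolynomial (Fin r) ℂ, D (aeval F a) = 0 := by
    intro a
    induction a using MvPolynomial.induction_on with
    | C a => simp
    | add p q hp hq => rw [map_add, map_add, hp, hq, add_zero]
    | mul_X p i hp => rw [map_mul, aeval_X, Derivation.leibniz, hp, hD, smul_zero, smul_zero, add_zero]
  have heval : ∀ (a : MvPolynomial (Fin r) ℂ) (p : Polynomial (MvPolynomial (Fin r) ℂ)),
      D (p.eval₂ (aeval F).toRingHom a) = p.derivative.eval₂ (aeval F).toRingHom a * D a := by
    intro a p
    induction p using Polynomial.induction_on' with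
    | add p q hp hq => rw [Polynomial.eval₂_add, map_add, hp, hq, Polynomial.derivative_add, Polynomial.eval₂_add, add_mul]
    | monomial n c =>
      have : D ((aeval F).toRingHom c) = 0 := hφ c
      rw [Polynomial.eval₂_monomial, Derivation.leibniz, this, Polynomial.derivative_monomial,
        Polynomial.eval₂_monomial, Derivation.leibniz_pow]
      simp
      ring
  ext i
  simp only [Derivation.coe_zero, Pi.zero_apply]
  congr 1
  set a : MvPolynomial (Fin r) ℂ := X i
  classical
  have hex : ∃ n, ∃ p : Polynomial (MvPolynomial (Fin r) ℂ), p ≠ 0 ∧ p.natDegree = n ∧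
      p.eval₂ (aeval F).toRingHom a = 0 := by
    obtain ⟨p, hp, h⟩ := phi_integral H a
    exact ⟨_, p, hp.ne_zero, rfl, h⟩
  obtain ⟨p, hp0, hpn, hpe⟩ := Nat.find_spec hex
  have hmin := fun m hm => Nat.find_min hex (m := m) hm
  have h1 := heval a p
  rw [hpe, map_zero] at h1
  rcases mul_eq_zero.1 h1.symm with h2 | h2
  · exfalso
    by_cases hd : p.natDegree = 0
    · rw [Polynomial.eq_C_of_natDegree_eq_zero hd, Polynomial.eval₂_C] at hpe
      apply hp0
      rw [Polynomial.eq_C_of_natDegree_eq_zero hd]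
      have : p.coeff 0 = 0 := phi_inj H (by rw [map_zero]; exact hpe)
      rw [this, map_zero]
    · refine hmin _ ?_ ⟨p.derivative, ?_, rfl, h2⟩
      · rw [← hpn]; exact Polynomial.natDegree_derivative_lt hd
      · intro h3
        exact hd (Polynomial.derivative_eq_zero.1 h3)
  · exact h2

noncomputable def dF (F : Fin r → MvPolynomial (Fin r) ℂ) :
    (Fin r → MvPolynomial (Fin r) ℂ) →ₗ[MvPolynomial (Fin r) ℂ] (Fin r → MvPolynomial (Fin r) ℂ) :=
  Matrix.mulVecLin (Matrix.of fun i j => pderiv j (F i))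

lemma dF_apply (u i) : dF F u i = ∑ j, pderiv j (F i) * u j := by
  simp [dF, Matrix.mulVec, dotProduct]

noncomputable def vecD (u : Fin r → MvPolynomial (Fin r) ℂ) :
  Derivation ℂ (MvPolynomial (Fin r) ℂ) (MvPolynomial (Fin r) ℂ) := mkDerivation ℂ u

lemma vecD_apply (u : Fin r → MvPolynomial (Fin r) ℂ) (p : MvPolynomial (Fin r) ℂ) :
    vecD u p = ∑ j, pderiv j p * u j := by
  classical
  induction p using MvPolynomial.induction_on with
  | C a => simp
  | add p q hp hq => simp [hp, hq, add_mul, Finset.sum_add_distrib]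
  | mul_X p i hp =>
    have h1 : vecD u (X i) = u i := by simp [vecD]
    simp only [Derivation.leibniz, hp, h1, pderiv_X, smul_eq_mul, add_mul,
      Finset.sum_add_distrib, Finset.mul_sum]
    congr 1
    · rw [Finset.sum_eq_single i]
      · simp
      · intro j _ hj; simp [Pi.single_eq_of_ne hj.symm]
      · simp
    · exact Finset.sum_congr rfl fun j _ => by ring

lemma dF_vecD (u i) : dF F u i = vecD u (F i) := by rw [dF_apply, vecD_apply]

include H in
lemma dF_injective : Function.Injective (dF F) := by
  rw [← LinearMap.ker_eq_bot, LinearMap.ker_eq_bot']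
  intro u hu
  have := der_zero H (vecD u) (fun i => by rw [← dF_vecD, hu]; rfl)
  ext1 i
  have h2 := congrArg (fun D => D (X i)) this
  simpa [vecD] using h2

lemma der_chain (D : Derivation ℂ (MvPolynomial (Fin r) ℂ) (MvPolynomial (Fin r) ℂ)) (p : MvPolynomial (Fin r) ℂ) :
    D (aeval F p) = ∑ i, aeval F (pderiv i p) * D (F i) := by
  classical
  induction p using MvPolynomial.induction_on with
  | C a => simp
  | add p q hp hq => rw [map_add, map_add, hp, hq]; simp only [map_add, add_mul, Finset.sum_add_distrib]
  | mul_X p i hp =>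
    simp only [map_mul, aeval_X, Derivation.leibniz, hp, pderiv_X, smul_eq_mul, map_add, add_mul,
      Finset.sum_add_distrib, Finset.mul_sum]
    congr 1
    · rw [Finset.sum_eq_single i]
      · simp
      · intro j _ hj; simp [Pi.single_eq_of_ne hj.symm]
      · simp
    · exact Finset.sum_congr rfl fun j _ => by ring
end Rho

section Step5
variable {r q : ℕ} {F : Fin r → MvPolynomial (Fin r) ℂ} {s : Finset (Fin r →₀ ℕ)}

def Esub (h : MvPolynomial (Fin r) ℂ) :
    Submodule (MvPolynomial (Fin r) ℂ) (Fin r → MvPolynomial (Fin r) ℂ) where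
  carrier := {u | ∑ i, u i * pderiv i h = 0}
  add_mem' {a b} ha hb := by
    change ∑ i, (a i + b i) * pderiv i h = 0
    simp only [add_mul, Finset.sum_add_distrib]
    rw [show ∑ i, a i * pderiv i h = 0 from ha, show ∑ i, b i * pderiv i h = 0 from hb, add_zero]
  zero_mem' := by
    change ∑ i, (0 : MvPolynomial (Fin r) ℂ) * pderiv i h = 0
    simp
  smul_mem' c a ha := by
    change ∑ i, (c * a i) * pderiv i h = 0
    simp only [mul_assoc, ← Finset.mul_sum]
    rw [show ∑ i, a i * pderiv i h = 0 from ha, mul_zero]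

noncomputable def Nsub (h : MvPolynomial (Fin r) ℂ) :
    Submodule (MvPolynomial (Fin r) ℂ) (Fin r → MvPolynomial (Fin r) ℂ) where
  carrier := {u | ∀ y : Fin r → ℂ, ∑ i, C (eval y (pderiv i h)) * u i = 0}
  add_mem' {a b} ha hb y := by
    change ∑ i, C (eval y (pderiv i h)) * (a i + b i) = 0
    simp only [mul_add, Finset.sum_add_distrib]
    rw [ha y, hb y, add_zero]
  zero_mem' y := by
    change ∑ i, C (eval y (pderiv i h)) * (0 : MvPolynomial (Fin r) ℂ) = 0
    simp
  smul_mem' c a ha y := by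
    change ∑ i, C (eval y (pderiv i h)) * (c * a i) = 0
    simp only [mul_left_comm _ c, ← Finset.mul_sum]
    rw [ha y, mul_zero]

lemma mem_Esub {h : MvPolynomial (Fin r) ℂ} {u} : u ∈ Esub h ↔ ∑ i, u i * pderiv i h = 0 := Iff.rfl
lemma mem_Nsub {h : MvPolynomial (Fin r) ℂ} {u} :
  u ∈ Nsub h ↔ ∀ y : Fin r → ℂ, ∑ i, C (eval y (pderiv i h)) * u i = 0 := Iff.rfl

noncomputable def phiV (F : Fin r → MvPolynomial (Fin r) ℂ) (u : Fin r → MvPolynomial (Fin r) ℂ) :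
    Fin r → MvPolynomial (Fin r) ℂ := fun i => aeval F (u i)

noncomputable def rhoV (H : FreeData q F s) (β : Fin r →₀ ℕ) (u : Fin r → MvPolynomial (Fin r) ℂ) :
    Fin r → MvPolynomial (Fin r) ℂ := fun i => rho H β (u i)

variable (H : FreeData q F s) {h : MvPolynomial (Fin r) ℂ}

lemma N_phi {u} (hu : u ∈ Nsub h) : phiV F u ∈ Nsub h := by
  intro y
  have := congrArg (aeval F) (hu y)
  simpa only [phiV, map_sum, map_mul, algHom_C, algebraMap_eq, map_zero] using this

lemma N_of_phi (H : FreeData q F s) {u} (hu : phiV F u ∈ Nsub h) : u ∈ Nsub h := by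
  intro y
  apply phi_inj H
  simpa only [phiV, map_sum, map_mul, algHom_C, algebraMap_eq, map_zero] using hu y

lemma N_rho {u} (hu : u ∈ Nsub h) {β} (hβ : β ∈ s) : rhoV H β u ∈ Nsub h := by
  intro y
  have := congrArg (rho H β) (hu y)
  simpa only [rhoV, rho_sum H _ hβ, rho_C_mul H hβ, rho_zero H hβ] using this

lemma N_hc {u} (hu : u ∈ Nsub h) (e : ℕ) : (fun i => homogeneousComponent e (u i)) ∈ Nsub h := by
  intro y
  have := congrArg (homogeneousComponent e) (hu y)
  simpa only [map_sum, homogeneousComponent_C_mul, map_zero] using this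

lemma N_const {u : Fin r → MvPolynomial (Fin r) ℂ} (h0 : ∀ i, (u i).IsHomogeneous 0)
    (hu : u ∈ Esub h) : u ∈ Nsub h := by
  have h1 : ∀ i, ∃ c, u i = C c := fun i => by
    have := homogeneousComponent_eq_self (h0 i)
    rw [homogeneousComponent_zero] at this
    exact ⟨_, this.symm⟩
  choose c hc using h1
  intro y
  have := congrArg (eval y) (mem_Esub.1 hu)
  simp only [hc, map_sum, map_mul, eval_C, map_zero] at this
  simp only [hc, ← C_mul, ← map_sum]
  rw [← C_0, ← this]
  congr 1
  exact Finset.sum_congr rfl fun i _ => mul_comm _ _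

lemma N_of_rho {u : Fin r → MvPolynomial (Fin r) ℂ} (hu : ∀ β ∈ s, rhoV H β u ∈ Nsub h) : u ∈ Nsub h := by
  have : u = ∑ β ∈ s, (monomial β (1:ℂ)) • phiV F (rhoV H β u) := by
    ext1 i
    rw [Finset.sum_apply]
    exact (rho_spec H (u i)).symm
  rw [this]
  exact Submodule.sum_mem _ fun β hβ => Submodule.smul_mem _ _ (N_phi (hu β hβ))

lemma dF_hom (hF : ∀ i, (F i).IsHomogeneous q) {u : Fin r → MvPolynomial (Fin r) ℂ} {e : ℕ}
    (hu : ∀ i, (u i).IsHomogeneous e) (i) : (dF F u i).IsHomogeneous (q - 1 + e) := by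
  rw [dF_apply]
  exact IsHomogeneous.sum _ _ _ fun j _ => ((hF i).pderiv).mul (hu j)

lemma E_dF_rho {lam : ℂ} (hinv : aeval F h = C lam * h ^ q) {u} (hu : u ∈ Esub h) {β} (hβ : β ∈ s) :
    rhoV H β (dF F u) ∈ Esub h := by
  have h1 : vecD u h = 0 := by
    rw [vecD_apply, ← mem_Esub.1 hu]
    exact Finset.sum_congr rfl fun i _ => mul_comm _ _
  have h2 : ∑ i, aeval F (pderiv i h) * dF F u i = 0 := by
    have := der_chain (F := F) (vecD u) h
    rw [hinv, Derivation.leibniz, Derivation.leibniz_pow, h1] at this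
    simp only [dF_vecD]
    rw [← this]
    simp [vecD]
  rw [mem_Esub]
  have := congrArg (rho H β) h2
  rw [rho_sum H _ hβ, rho_zero H hβ] at this
  rw [← this]
  exact Finset.sum_congr rfl fun i _ => by rw [rho_mul H hβ, mul_comm]; rfl

lemma rhoV_hom {u : Fin r → MvPolynomial (Fin r) ℂ} {e : ℕ} (hu : ∀ i, (u i).IsHomogeneous e)
    {β} (hβ : β ∈ s) : rhoV H β u = 0 ∨ ∃ j, q * j + β.degree = e ∧ ∀ i, (rhoV H β u i).IsHomogeneous j := by
  by_cases hj : ∃ j, q * j + β.degree = e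
  · obtain ⟨j, hj⟩ := hj
    exact Or.inr ⟨j, hj, fun i => rho_hom H hβ (hu i) hj⟩
  · left
    push Not at hj
    ext1 i
    exact rho_hom_zero H hβ (hu i) hj

include H in
lemma dF_N {lam : ℂ} (hinv : aeval F h = C lam * h ^ q) {u} (hu : u ∈ Nsub h) : dF F u ∈ Nsub h := by
  classical
  have hq := H.hq
  have hconst : ∀ v : Fin r → MvPolynomial (Fin r) ℂ, (∀ i, (v i).IsHomogeneous 0) → v ∈ Esub h →
      dF F v ∈ Nsub h := by
    intro v hv hvE
    apply N_of_rho H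
    intro β hβ
    rcases rhoV_hom H (dF_hom H.endo.1 hv) hβ with h1 | ⟨j, hj, h1⟩
    · rw [h1]; exact zero_mem _
    · have : j = 0 := by
        rcases Nat.eq_zero_or_pos j with h | h
        · exact h
        · have := Nat.le_mul_of_pos_right q h
          omega
      subst this
      exact N_const h1 (E_dF_rho H hinv hvE hβ)
  -- expand in coefficients
  let T : Finset (Fin r →₀ ℕ) := Finset.univ.biUnion fun i => (u i).support
  have hu2 : u = ∑ α ∈ T, (monomial α (1:ℂ)) • fun i => C (coeff α (u i)) := by
    ext1 i
    rw [Finset.sum_apply]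
    simp only [Pi.smul_apply, smul_eq_mul]
    conv_lhs => rw [(u i).as_sum]
    rw [Finset.sum_subset (s₂ := T)]
    · refine Finset.sum_congr rfl fun α _ => ?_
      rw [mul_comm, C_mul_monomial, mul_one]
    · intro α hα
      exact Finset.mem_biUnion.2 ⟨i, Finset.mem_univ _, hα⟩
    · intro α _ hα
      rw [notMem_support_iff.1 hα, map_zero]
  rw [hu2, map_sum]
  refine Submodule.sum_mem _ fun α _ => ?_
  rw [map_smul]
  refine Submodule.smul_mem _ _ (hconst _ (fun i => isHomogeneous_C _ _) ?_)
  rw [mem_Esub]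
  apply MvPolynomial.funext
  intro y
  have := congrArg (coeff α) (hu y)
  simp only [coeff_sum, coeff_C_mul, coeff_zero] at this
  simp only [map_sum, map_mul, eval_C, map_zero]
  rw [← this]
  exact Finset.sum_congr rfl fun i _ => mul_comm _ _

include H in
lemma dF_N_iff {lam : ℂ} (hinv : aeval F h = C lam * h ^ q) {u} : dF F u ∈ Nsub h ↔ u ∈ Nsub h := by
  refine ⟨fun hu => ?_, dF_N H hinv⟩
  set M := (Nsub h).comap (dF F)
  have hNM : Nsub h ≤ M := fun u hu => dF_N H hinv hu
  -- f : M → N injective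
  let f : M →ₗ[MvPolynomial (Fin r) ℂ] Nsub h :=
    ((dF F).comp M.subtype).codRestrict (Nsub h) (fun x => x.2)
  have hf : Function.Injective f := by
    intro a b hab
    have := congrArg Subtype.val hab
    exact Subtype.ext (dF_injective H this)
  have h1 := LinearMap.rank_le_of_injective f hf
  let N' := (Nsub h).submoduleOf M
  have e : N' ≃ₗ[MvPolynomial (Fin r) ℂ] Nsub h := Submodule.submoduleOfEquivOfLe hNM
  have h2 := rank_quotient_add_rank_of_isDomain N'
  rw [e.rank_eq] at h2
  have h3 : Module.rank (MvPolynomial (Fin r) ℂ) M < Cardinal.aleph0 := by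
    exact Module.rank_lt_aleph0 _ _
  have h4 : Module.rank (MvPolynomial (Fin r) ℂ) (M ⧸ N') = 0 := by
    have h5 : Module.rank (MvPolynomial (Fin r) ℂ) (Nsub h) < Cardinal.aleph0 := Module.rank_lt_aleph0 _ _
    rw [← h2] at h1
    have := (Cardinal.add_le_add_iff_of_lt_aleph0 h5).1 (h1.trans (zero_add _).ge)
    simpa using this
  rw [Module.rank_eq_zero_iff_isTorsion] at h4
  obtain ⟨a, ha⟩ := @h4 (Submodule.Quotient.mk ⟨u, hu⟩)
  rw [Submonoid.smul_def, ← Submodule.Quotient.mk_smul, Submodule.Quotient.mk_eq_zero] at ha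
  have h6 : (a : MvPolynomial (Fin r) ℂ) • u ∈ Nsub h := ha
  intro y
  have h7 := h6 y
  simp only [Pi.smul_apply, smul_eq_mul, mul_left_comm _ (a : MvPolynomial (Fin r) ℂ), ← Finset.mul_sum] at h7
  exact (mul_eq_zero.1 h7).resolve_left (nonZeroDivisors.coe_ne_zero a)
end Step5

section Step6
variable {r q : ℕ} {F : Fin r → MvPolynomial (Fin r) ℂ} {s : Finset (Fin r →₀ ℕ)}

noncomputable def S1 (h : MvPolynomial (Fin r) ℂ) : Submodule ℂ (Fin r → MvPolynomial (Fin r) ℂ) where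
  carrier := {u | (∀ i, (u i).IsHomogeneous 1) ∧ u ∈ Esub h}
  add_mem' {a b} ha hb := ⟨fun i => (ha.1 i).add (hb.1 i), Submodule.add_mem _ ha.2 hb.2⟩
  zero_mem' := ⟨fun i => isHomogeneous_zero _ _ _, Submodule.zero_mem _⟩
  smul_mem' c a ha := ⟨fun i => Submodule.smul_mem (homogeneousSubmodule (Fin r) ℂ 1) c (ha.1 i),
    Submodule.smul_of_tower_mem _ c ha.2⟩

lemma S1_finite (h : MvPolynomial (Fin r) ℂ) : Module.Finite ℂ (S1 h) := by
  let f : S1 h →ₗ[ℂ] (Fin r → Fin r → ℂ) :=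
    { toFun := fun u i j => coeff (Finsupp.single j 1) (u.1 i)
      map_add' := fun a b => by ext i j; simp
      map_smul' := fun c a => by ext i j; simp }
  refine Module.Finite.of_injective f ?_
  intro a b hab
  ext i α
  by_cases hα : α.degree = 1
  · obtain ⟨j, rfl⟩ : ∃ j, α = Finsupp.single j 1 := by
      have h1 : α ∈ {p : Fin r →₀ ℕ | p.degree = 1} := hα
      rw [← Finsupp.range_single_one] at h1
      obtain ⟨j, hj⟩ := h1
      exact ⟨j, hj.symm⟩
    exact congrFun (congrFun hab i) j
  · rw [(a.2.1 i).coeff_eq_zero hα, (b.2.1 i).coeff_eq_zero hα]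

variable (H : FreeData q F s) {h : MvPolynomial (Fin r) ℂ} {lam : ℂ}

include H in
lemma S1_surj (hinv : aeval F h = C lam * h ^ q) {B'} (hB' : B' ∈ S1 h) :
    ∃ B ∈ S1 h, dF F B - phiV F B' ∈ Nsub h := by
  classical
  have hq := H.hq
  have hM1 : ∀ B ∈ S1 h, rhoV H 0 (dF F B) ∈ S1 h := by
    intro B hB
    refine ⟨fun i => rho_hom H H.zero_mem (dF_hom H.endo.1 hB.1 i) ?_, E_dF_rho H hinv hB.2 H.zero_mem⟩
    simp; omega
  have hM2 : ∀ B ∈ S1 h, dF F B - phiV F (rhoV H 0 (dF F B)) ∈ Nsub h := by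
    intro B hB
    have h1 : dF F B = ∑ β ∈ s, (monomial β (1:ℂ)) • phiV F (rhoV H β (dF F B)) := by
      ext1 i
      rw [Finset.sum_apply]
      exact (rho_spec H _).symm
    have h2 : dF F B - phiV F (rhoV H 0 (dF F B)) =
        ∑ β ∈ s.erase 0, (monomial β (1:ℂ)) • phiV F (rhoV H β (dF F B)) := by
      have h3 := h1
      rw [← Finset.sum_erase_add _ _ H.zero_mem,
        show (monomial (0 : Fin r →₀ ℕ) (1:ℂ)) = 1 from rfl, one_smul] at h3
      exact sub_eq_iff_eq_add.2 h3
    rw [h2]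
    refine Submodule.sum_mem _ fun β hβ => Submodule.smul_mem _ _ (N_phi ?_)
    obtain ⟨hβ0, hβ⟩ := Finset.mem_erase.1 hβ
    rcases rhoV_hom H (dF_hom H.endo.1 hB.1) hβ with h1 | ⟨j, hj, h1⟩
    · rw [h1]; exact zero_mem _
    · have hd : β.degree ≠ 0 := by rwa [Ne, Finsupp.degree_eq_zero_iff]
      have : j = 0 := by
        rcases Nat.eq_zero_or_pos j with h | h
        · exact h
        · have := Nat.le_mul_of_pos_right q h
          omega
      subst this
      exact N_const h1 (E_dF_rho H hinv hB.2 hβ)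
  let M : S1 h →ₗ[ℂ] S1 h :=
    { toFun := fun B => ⟨rhoV H 0 (dF F B.1), hM1 B.1 B.2⟩
      map_add' := fun a b => by
        apply Subtype.ext
        ext1 i
        change rho H 0 (dF F (a.1 + b.1) i) = rho H 0 (dF F a.1 i) + rho H 0 (dF F b.1 i)
        rw [map_add, ← rho_add H H.zero_mem]; rfl
      map_smul' := fun c a => by
        apply Subtype.ext
        ext1 i
        change rho H 0 (dF F (c • a.1) i) = c • rho H 0 (dF F a.1 i)
        have : c • a.1 = (C c : MvPolynomial (Fin r) ℂ) • a.1 := by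
          ext1 i; simp [smul_eq_C_mul]
        rw [this, map_smul, smul_eq_C_mul, ← rho_C_mul H H.zero_mem]; rfl }
  let Q : Submodule ℂ (S1 h) := ((Nsub h).restrictScalars ℂ).comap (S1 h).subtype
  have hQ : ∀ B : S1 h, B ∈ Q ↔ B.1 ∈ Nsub h := fun B => Iff.rfl
  have hMQ : Q ≤ Q.comap M := by
    intro B hB
    exact N_rho H (dF_N H hinv hB) H.zero_mem
  have := S1_finite h
  have hinj : Function.Injective (Q.mapQ Q M hMQ) := by
    rw [← LinearMap.ker_eq_bot, LinearMap.ker_eq_bot']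
    intro m hm
    obtain ⟨B, rfl⟩ := Submodule.Quotient.mk_surjective _ m
    rw [Submodule.mapQ_apply, Submodule.Quotient.mk_eq_zero, hQ] at hm
    rw [Submodule.Quotient.mk_eq_zero, hQ, ← dF_N_iff H hinv]
    have h3 := Submodule.add_mem _ (hM2 B.1 B.2) (N_phi (F := F) hm)
    simpa [M] using h3
  have hsurj := LinearMap.surjective_of_injective hinj
  obtain ⟨m, hm⟩ := hsurj (Submodule.Quotient.mk ⟨B', hB'⟩)
  obtain ⟨B, rfl⟩ := Submodule.Quotient.mk_surjective _ m
  rw [Submodule.mapQ_apply, Submodule.Quotient.eq, hQ] at hm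
  refine ⟨B.1, B.2, ?_⟩
  have h3 := Submodule.add_mem _ (hM2 B.1 B.2) (N_phi (F := F) hm)
  convert h3 using 1
  ext1 i
  simp [phiV, M]

noncomputable def Tsub (h : MvPolynomial (Fin r) ℂ) :
    Submodule (MvPolynomial (Fin r) ℂ) (Fin r → MvPolynomial (Fin r) ℂ) :=
  Submodule.span _ (S1 h : Set (Fin r → MvPolynomial (Fin r) ℂ)) ⊔ Nsub h

include H in
lemma T_lift (hinv : aeval F h = C lam * h ^ q) {θ} (hθ : θ ∈ Tsub h) :
    ∃ ψ ∈ Tsub h, dF F ψ - phiV F θ ∈ Nsub h := by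
  rw [Tsub, Submodule.mem_sup] at hθ
  obtain ⟨a, ha, b, hb, rfl⟩ := hθ
  have h1 : ∃ ψ ∈ Tsub h, dF F ψ - phiV F a ∈ Nsub h := by
    induction ha using Submodule.span_induction with
    | mem x hx =>
      obtain ⟨B, hB, h2⟩ := S1_surj H hinv hx
      exact ⟨B, Submodule.mem_sup_left (Submodule.subset_span hB), h2⟩
    | zero =>
      refine ⟨0, zero_mem _, ?_⟩
      have : phiV F 0 = 0 := by ext1 i; simp [phiV]
      rw [this]; simp
    | add x y _ _ hx hy =>
      obtain ⟨ψ, h1, h2⟩ := hx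
      obtain ⟨ψ', h1', h2'⟩ := hy
      refine ⟨ψ + ψ', Submodule.add_mem _ h1 h1', ?_⟩
      convert Submodule.add_mem _ h2 h2' using 1
      ext1 i
      simp [phiV]; ring
    | smul c x _ hx =>
      obtain ⟨ψ, h1, h2⟩ := hx
      refine ⟨aeval F c • ψ, Submodule.smul_mem _ _ h1, ?_⟩
      convert Submodule.smul_mem _ (aeval F c) h2 using 1
      ext1 i
      simp [phiV, mul_sub]
  obtain ⟨ψ, h1, h2⟩ := h1
  refine ⟨ψ, h1, ?_⟩
  convert Submodule.sub_mem _ h2 (N_phi (F := F) hb) using 1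
  ext1 i
  simp [phiV]; ring

include H in
lemma E_le_T (hinv : aeval F h = C lam * h ^ q) (e : ℕ) : ∀ θ ∈ Esub h, (∀ i, (θ i).IsHomogeneous e) →
    θ ∈ Tsub h := by
  have hq := H.hq
  induction e using Nat.strong_induction_on with
  | _ e ih =>
  intro θ hθ hhom
  rcases Nat.lt_or_ge e 2 with he | he
  · interval_cases e
    · exact Submodule.mem_sup_right (N_const hhom hθ)
    · exact Submodule.mem_sup_left (Submodule.subset_span ⟨hhom, hθ⟩)
  · have h1 : ∀ β, ∃ ψ ∈ Tsub h, β ∈ s → dF F ψ - phiV F (rhoV H β (dF F θ)) ∈ Nsub h := by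
      intro β
      by_cases hβ : β ∈ s
      · have hT : rhoV H β (dF F θ) ∈ Tsub h := by
          rcases rhoV_hom H (dF_hom H.endo.1 hhom) hβ with h1 | ⟨j, hj, h1⟩
          · rw [h1]; exact zero_mem _
          · refine ih j ?_ _ (E_dF_rho H hinv hθ hβ) h1
            by_contra hcon
            have h5 : q * e ≤ q * j := Nat.mul_le_mul_left _ (by omega)
            obtain ⟨q', rfl⟩ : ∃ q', q = q' + 1 := ⟨q - 1, by omega⟩
            have h6 : q' * 2 ≤ q' * e := Nat.mul_le_mul_left _ he
            rw [add_mul] at h5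
            omega
        obtain ⟨ψ, h2, h3⟩ := T_lift H hinv hT
        exact ⟨ψ, h2, fun _ => h3⟩
      · exact ⟨0, zero_mem _, fun h => absurd h hβ⟩
    choose ψ h1 h2 using h1
    have h3 : θ - ∑ β ∈ s, (monomial β (1:ℂ)) • ψ β ∈ Nsub h := by
      rw [← dF_N_iff H hinv]
      have h4 : dF F θ = ∑ β ∈ s, (monomial β (1:ℂ)) • phiV F (rhoV H β (dF F θ)) := by
        ext1 i
        rw [Finset.sum_apply]
        exact (rho_spec H _).symm
      have h5 : dF F (θ - ∑ β ∈ s, (monomial β (1:ℂ)) • ψ β) =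
          - ∑ β ∈ s, (monomial β (1:ℂ)) • (dF F (ψ β) - phiV F (rhoV H β (dF F θ))) := by
        rw [map_sub, map_sum]
        simp only [map_smul, smul_sub, Finset.sum_sub_distrib]
        rw [← h4]; abel
      rw [h5]
      exact Submodule.neg_mem _ (Submodule.sum_mem _ fun β hβ => Submodule.smul_mem _ _ (h2 β hβ))
    have h4 := Submodule.add_mem _ (Submodule.mem_sup_right h3 : _ ∈ Tsub h)
      (Submodule.sum_mem (Tsub h) fun β (_ : β ∈ s) => Submodule.smul_mem _ (monomial β (1:ℂ)) (h1 β))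
    rwa [sub_add_cancel] at h4

include H in
/-- homogeneous lifting -/
lemma lift_hom (hinv : aeval F h = C lam * h ^ q) {e : ℕ} (θ) (hθ : θ ∈ Esub h)
    (hhom : ∀ i, (θ i).IsHomogeneous e) (he : 1 ≤ e) :
    ∃ ψ, (∀ i, (ψ i).IsHomogeneous (q * e - (q - 1))) ∧ dF F ψ - phiV F θ ∈ Nsub h := by
  have hq := H.hq
  obtain ⟨ψ, -, hψ⟩ := T_lift H hinv (E_le_T H hinv e θ hθ hhom)
  refine ⟨fun i => homogeneousComponent (q * e - (q - 1)) (ψ i),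
    fun i => homogeneousComponent_isHomogeneous _ _, ?_⟩
  have h1 := N_hc hψ (q * e)
  have hqe : q * 1 ≤ q * e := Nat.mul_le_mul_left _ he
  convert h1 using 1
  ext1 i
  simp only [Pi.sub_apply, map_sub, phiV]
  congr 1
  · rw [dF_apply, dF_apply, map_sum]
    refine Finset.sum_congr rfl fun j _ => ?_
    rw [hc_mul ((H.endo.1 i).pderiv), if_pos (by omega)]
  · symm
    apply homogeneousComponent_eq_self
    exact (hhom i).aeval F H.endo.1
end Step6

lemma cech_vanish {A ι : Type*} [CommRing A] [IsDomain A] [Fintype ι] (g : ι → A) (f : ι → ι → A)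
    (anti : ∀ i j, f i j + f j i = 0)
    (coc : ∀ i j k, g k * f i j + g i * f j k + g j * f k i = 0)
    (γ1 γ2 γ3 : ι → A) (G1 G2 G3 : A) (h1 : G1 = ∑ k, γ1 k * g k) (h2 : G2 = ∑ k, γ2 k * g k)
    (h3 : G3 = ∑ k, γ3 k * g k) (hG1 : G1 ≠ 0)
    (r2 : ∀ a b, G2 * a = G1 * b → ∃ c, a = G1 * c)
    (r3 : ∀ a b c, G3 * a = G1 * b + G2 * c → ∃ b' c', a = G1 * b' + G2 * c') :
    ∃ w : ι → A, ∀ i j, f i j = g i * w j - g j * w i := by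
  obtain ⟨φ, hφ⟩ : ∃ φ : ι → A, ∀ j, φ j = ∑ k, γ1 k * f k j := ⟨_, fun _ => rfl⟩
  have e1 : ∀ i j, G1 * f i j = g i * φ j - g j * φ i := by
    intro i j
    rw [h1, hφ, hφ, Finset.sum_mul, Finset.mul_sum, Finset.mul_sum, ← Finset.sum_sub_distrib]
    refine Finset.sum_congr rfl fun k _ => ?_
    linear_combination γ1 k * coc i j k - γ1 k * g i * anti j k
  obtain ⟨τ, hτ⟩ : ∃ τ : A, τ = ∑ k, γ2 k * φ k := ⟨_, rfl⟩
  obtain ⟨w', hw'⟩ : ∃ w' : ι → A, ∀ j, w' j = ∑ k, γ2 k * f k j := ⟨_, fun _ => rfl⟩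
  have e2 : ∀ j, G2 * φ j - g j * τ = G1 * w' j := by
    intro j
    rw [hw', h2, hτ, Finset.sum_mul, Finset.mul_sum, Finset.mul_sum, ← Finset.sum_sub_distrib]
    refine Finset.sum_congr rfl fun k _ => ?_
    linear_combination - γ2 k * e1 k j
  have e3 : G3 * τ = G1 * (- ∑ j, γ3 j * w' j) + G2 * ∑ j, γ3 j * φ j := by
    rw [h3, Finset.sum_mul, ← Finset.sum_neg_distrib, Finset.mul_sum, Finset.mul_sum, ← Finset.sum_add_distrib]
    refine Finset.sum_congr rfl fun j _ => ?_
    linear_combination - γ3 j * e2 j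
  obtain ⟨a, b, hab⟩ := r3 _ _ _ e3
  have e4 : ∀ j, ∃ c, φ j - g j * b = G1 * c := fun j =>
    r2 _ (w' j + g j * a) (by rw [hab] at e2; linear_combination e2 j)
  choose w hw using e4
  refine ⟨w, fun i j => mul_left_cancel₀ hG1 ?_⟩
  linear_combination e1 i j + g i * hw j - g j * hw i

section Step7
variable {r q : ℕ} {F : Fin r → MvPolynomial (Fin r) ℂ} {s : Finset (Fin r →₀ ℕ)}
variable (H : FreeData q F s)

include H in
lemma reg2_phi {y1 y2 : MvPolynomial (Fin r) ℂ}
    (r2 : ∀ a b, y2 * a = y1 * b → ∃ c, a = y1 * c) :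
    ∀ a b, aeval F y2 * a = aeval F y1 * b → ∃ c, a = aeval F y1 * c := by
  intro a b hab
  have h1 : ∀ β, ∃ c, β ∈ s → rho H β a = y1 * c := by
    intro β
    by_cases hβ : β ∈ s
    · have := congrArg (rho H β) hab
      rw [rho_mul H hβ, rho_mul H hβ] at this
      obtain ⟨c, hc⟩ := r2 _ _ this
      exact ⟨c, fun _ => hc⟩
    · exact ⟨0, fun h => absurd h hβ⟩
  choose c hc using h1
  refine ⟨∑ β ∈ s, monomial β 1 * aeval F (c β), ?_⟩
  rw [Finset.mul_sum]
  conv_lhs => rw [← rho_spec H a]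
  refine Finset.sum_congr rfl fun β hβ => ?_
  rw [hc β hβ, map_mul]; ring

include H in
lemma reg3_phi {y1 y2 y3 : MvPolynomial (Fin r) ℂ}
    (r3 : ∀ a b c, y3 * a = y1 * b + y2 * c → ∃ b' c', a = y1 * b' + y2 * c') :
    ∀ a b c, aeval F y3 * a = aeval F y1 * b + aeval F y2 * c →
      ∃ b' c', a = aeval F y1 * b' + aeval F y2 * c' := by
  intro a b c hab
  have h1 : ∀ β, ∃ b' c', β ∈ s → rho H β a = y1 * b' + y2 * c' := by
    intro β
    by_cases hβ : β ∈ s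
    · have := congrArg (rho H β) hab
      rw [rho_add H hβ, rho_mul H hβ, rho_mul H hβ, rho_mul H hβ] at this
      obtain ⟨b', c', hc⟩ := r3 _ _ _ this
      exact ⟨b', c', fun _ => hc⟩
    · exact ⟨0, 0, fun h => absurd h hβ⟩
  choose b' c' hc using h1
  refine ⟨∑ β ∈ s, monomial β 1 * aeval F (b' β), ∑ β ∈ s, monomial β 1 * aeval F (c' β), ?_⟩
  rw [Finset.mul_sum, Finset.mul_sum, ← Finset.sum_add_distrib]
  conv_lhs => rw [← rho_spec H a]
  refine Finset.sum_congr rfl fun β hβ => ?_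
  rw [hc β hβ, map_add, map_mul, map_mul]; ring

noncomputable def kos (h : MvPolynomial (Fin r) ℂ) (i j : Fin r) : Fin r → MvPolynomial (Fin r) ℂ :=
  Pi.single j (pderiv i h) - Pi.single i (pderiv j h)

lemma kos_sum {h : MvPolynomial (Fin r) ℂ} (i j) (c : Fin r → MvPolynomial (Fin r) ℂ) :
    ∑ k, c k * kos h i j k = c j * pderiv i h - c i * pderiv j h := by
  classical
  simp [kos, mul_sub, Finset.sum_sub_distrib, Pi.single_apply]

variable {h : MvPolynomial (Fin r) ℂ} {lam : ℂ}

include H in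
lemma step7a (hinv : aeval F h = C lam * h ^ q) {d : ℕ} (hd : 2 ≤ d) (hhom : h.IsHomogeneous d)
    (y1 y2 y3 : MvPolynomial (Fin r) ℂ)
    (hy1 : y1 ∈ Ideal.span (Set.range fun i => pderiv i h))
    (hy2 : y2 ∈ Ideal.span (Set.range fun i => pderiv i h))
    (hy3 : y3 ∈ Ideal.span (Set.range fun i => pderiv i h))
    (h0 : y1 ≠ 0)
    (r2 : ∀ a b, y2 * a = y1 * b → ∃ c, a = y1 * c)
    (r3 : ∀ a b c, y3 * a = y1 * b + y2 * c → ∃ b' c', a = y1 * b' + y2 * c') (i j) :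
    kos h i j ∈ Nsub h := by
  classical
  have hq := H.hq
  have kE : ∀ i j, kos h i j ∈ Esub h := by
    intro i j
    rw [mem_Esub]
    have := kos_sum (h := h) i j (fun k => pderiv k h)
    simp only [mul_comm (kos h i j _)]
    rw [this]; ring
  have khom : ∀ i j k, (kos h i j k).IsHomogeneous (d - 1) := by
    intro i j k
    have hh : ∀ i, (pderiv i h).IsHomogeneous (d-1) := fun i => hhom.pderiv
    simp only [kos, Pi.sub_apply, Pi.single_apply]
    refine IsHomogeneous.sub ?_ ?_ <;> split_ifs <;> first | exact hh _ | exact isHomogeneous_zero _ _ _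
  have := fun i j => lift_hom H hinv (kos h i j) (kE i j) (khom i j) (by omega)
  choose ψ ψhom ψN using this
  obtain ⟨g, hg⟩ : ∃ g : Fin r → MvPolynomial (Fin r) ℂ, ∀ i, g i = aeval F (pderiv i h) := ⟨_, fun _ => rfl⟩
  have anti : ∀ i j, ψ i j + ψ j i ∈ Nsub h := by
    intro i j
    rw [← dF_N_iff H hinv]
    convert Submodule.add_mem _ (ψN i j) (ψN j i) using 1
    rw [map_add]
    ext1 k
    have : kos h j i = - kos h i j := by simp [kos]
    simp only [Pi.add_apply, Pi.sub_apply, phiV, this, Pi.neg_apply, map_neg]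
    ring
  have coc : ∀ i j k, g k • ψ i j + g i • ψ j k + g j • ψ k i ∈ Nsub h := by
    intro i j k
    rw [← dF_N_iff H hinv]
    convert Submodule.add_mem _ (Submodule.add_mem _ (Submodule.smul_mem _ (g k) (ψN i j))
      (Submodule.smul_mem _ (g i) (ψN j k))) (Submodule.smul_mem _ (g j) (ψN k i)) using 1
    rw [map_add, map_add, map_smul, map_smul, map_smul]
    ext1 l
    have h1 : pderiv k h * kos h i j l + pderiv i h * kos h j k l + pderiv j h * kos h k i l = 0 := by
      simp only [kos, Pi.sub_apply, Pi.single_apply]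
      split_ifs <;> ring
    have h2 := congrArg (aeval F) h1
    rw [map_add, map_add, map_mul, map_mul, map_mul, map_zero, ← hg, ← hg, ← hg] at h2
    simp only [Pi.add_apply, Pi.sub_apply, phiV, Pi.smul_apply, smul_eq_mul]
    linear_combination h2
  have hGs : ∀ y ∈ Ideal.span (Set.range fun i => pderiv i h), ∃ γ : Fin r → MvPolynomial (Fin r) ℂ,
      aeval F y = ∑ k, γ k * g k := by
    intro y hy
    rw [Ideal.mem_span_range_iff_exists_fun] at hy
    obtain ⟨c, rfl⟩ := hy
    exact ⟨fun k => aeval F (c k), by simp only [map_sum, map_mul, hg]⟩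
  obtain ⟨γ1, hγ1⟩ := hGs y1 hy1
  obtain ⟨γ2, hγ2⟩ := hGs y2 hy2
  obtain ⟨γ3, hγ3⟩ := hGs y3 hy3
  have hψ : ∀ i j, ψ i j ∈ Nsub h := by
    intro i j y
    obtain ⟨w, hw⟩ := cech_vanish g (fun i j => ∑ k, C (eval y (pderiv k h)) * ψ i j k)
      (fun i j => by
        have := anti i j y
        simpa only [Pi.add_apply, mul_add, Finset.sum_add_distrib] using this)
      (fun i j k => by
        have := coc i j k y
        simp only [Pi.add_apply, Pi.smul_apply, smul_eq_mul, mul_add, Finset.sum_add_distrib] at this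
        simp only [Finset.mul_sum]
        simpa only [mul_left_comm] using this)
      γ1 γ2 γ3 _ _ _ hγ1 hγ2 hγ3 (fun h => h0 (phi_inj H (by rw [h, map_zero])))
      (reg2_phi H r2) (reg3_phi H r3)
    have hf := hw i j
    have hfh : (∑ k, C (eval y (pderiv k h)) * ψ i j k).IsHomogeneous (q * (d-1) - (q-1)) := by
      refine IsHomogeneous.sum _ _ _ fun k _ => ?_
      have := (isHomogeneous_C (Fin r) (eval y (pderiv k h))).mul (ψhom i j k)
      rwa [zero_add] at this
    have hgh : ∀ i, (g i).IsHomogeneous (q * (d-1)) := by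
      intro i
      rw [hg]
      exact (hhom.pderiv).aeval F H.endo.1
    have h4 : q * 1 ≤ q * (d-1) := Nat.mul_le_mul_left _ (by omega)
    rw [← homogeneousComponent_eq_self hfh]
    rw [hf, map_sub, hc_mul (hgh i), hc_mul (hgh j), if_neg (by omega), if_neg (by omega), sub_zero]
  apply N_of_phi H
  have h5 := Submodule.sub_mem _ (dF_N H hinv (hψ i j)) (ψN i j)
  rwa [sub_sub_cancel] at h5

include H in
lemma step7 (hinv : aeval F h = C lam * h ^ q) {d : ℕ} (hd : 2 ≤ d) (hhom : h.IsHomogeneous d)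
    (y1 y2 y3 : MvPolynomial (Fin r) ℂ)
    (hy1 : y1 ∈ Ideal.span (Set.range fun i => pderiv i h))
    (hy2 : y2 ∈ Ideal.span (Set.range fun i => pderiv i h))
    (hy3 : y3 ∈ Ideal.span (Set.range fun i => pderiv i h))
    (h0 : y1 ≠ 0)
    (r2 : ∀ a b, y2 * a = y1 * b → ∃ c, a = y1 * c)
    (r3 : ∀ a b c, y3 * a = y1 * b + y2 * c → ∃ b' c', a = y1 * b' + y2 * c') : False := by
  classical
  have hN := step7a H hinv hd hhom y1 y2 y3 hy1 hy2 hy3 h0 r2 r3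
  have h1 : ∃ j, pderiv j h ≠ 0 := by
    by_contra! hcon
    simp only [hcon] at hy1
    rw [Ideal.mem_span_range_iff_exists_fun] at hy1
    obtain ⟨c, hc⟩ := hy1
    exact h0 (by rw [← hc]; simp)
  obtain ⟨j, hj⟩ := h1
  obtain ⟨y, hy⟩ : ∃ y, eval y (pderiv j h) ≠ 0 := by
    by_contra! hcon
    exact hj (MvPolynomial.funext fun x => by rw [hcon, map_zero])
  have h2 : ∀ i, ∃ c, pderiv i h = C c * pderiv j h := by
    intro i
    refine ⟨eval y (pderiv i h) / eval y (pderiv j h), ?_⟩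
    have := hN i j y
    rw [kos_sum i j (fun k => C (eval y (pderiv k h))), sub_eq_zero] at this
    have h3 : C (eval y (pderiv j h)) ≠ (0 : MvPolynomial (Fin r) ℂ) := by
      rwa [Ne, C_eq_zero]
    apply mul_left_cancel₀ h3
    rw [this, ← mul_assoc, ← C_mul]
    congr 2
    field_simp
  have h3 : ∀ y ∈ Ideal.span (Set.range fun i => pderiv i h), ∃ u, y = u * pderiv j h := by
    intro y hy
    rw [Ideal.mem_span_range_iff_exists_fun] at hy
    obtain ⟨c, rfl⟩ := hy
    choose e he using h2
    refine ⟨∑ i, c i * C (e i), ?_⟩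
    rw [Finset.sum_mul]
    exact Finset.sum_congr rfl fun i _ => by rw [he i]; ring
  obtain ⟨u, hu⟩ := h3 y1 hy1
  obtain ⟨v, hv⟩ := h3 y2 hy2
  obtain ⟨c, hc⟩ := r2 u v (by rw [hu, hv]; ring)
  have h4 : u ≠ 0 := by rintro rfl; exact h0 (by rw [hu, zero_mul])
  have h5 : pderiv j h * c = 1 := by
    apply mul_left_cancel₀ h4
    rw [mul_one, ← mul_assoc, ← hu, ← hc]
  have h6 : (pderiv j h).IsHomogeneous (d-1) := hhom.pderiv
  have h7 : constantCoeff (pderiv j h) = 0 := by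
    rw [constantCoeff_eq]
    exact h6.coeff_eq_zero (by simp; omega)
  have := congrArg constantCoeff h5
  rw [map_mul, h7, zero_mul, map_one] at this
  exact zero_ne_one this
end Step7

lemma dim_le_of_int {R S : Type*} [CommRing R] [CommRing S] [IsDomain R] [IsDomain S] [Algebra R S]
    [Algebra.IsIntegral R S]
    (hinj : Function.Injective (algebraMap R S)) : ringKrullDim R ≤ ringKrullDim S := by
  refine iSup_le fun l => ?_
  have : FaithfulSMul R S := (faithfulSMul_iff_algebraMap_injective R S).2 hinj
  obtain ⟨P, hP, hP2⟩ := Ideal.exists_ideal_over_prime_of_isIntegral (S := S) l.head.asIdeal ⊥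
    (by rw [Ideal.comap_bot_of_injective _ hinj]; exact bot_le)
  have : P.LiesOver l.head.asIdeal := ⟨hP2.2.symm⟩
  have := hP2.1
  obtain ⟨L, hL⟩ := Ideal.exists_ltSeries_of_hasGoingUp (S := S) l P
  rw [← hL.1]
  exact Order.LTSeries.length_le_krullDim L

lemma not_indep {B : Type} [CommRing B] [Algebra ℂ B] [Algebra.FiniteType ℂ B]
    (hdim : ringKrullDim B ≤ 3) (x : Fin 4 → B) : ¬ AlgebraicIndependent ℂ x := by
  intro hx
  have hx' : Function.Injective (aeval x : MvPolynomial (Fin 4) ℂ →ₐ[ℂ] B) := hx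
  obtain ⟨P, hP, hPc⟩ := Ideal.exists_comap_eq_of_mem_minimalPrimes_of_injective
    (f := (aeval x : MvPolynomial (Fin 4) ℂ →ₐ[ℂ] B).toRingHom) hx' ⊥ (by simp [IsDomain.minimalPrimes_eq_singleton_bot])
  let x' : Fin 4 → B ⧸ P := fun i => Ideal.Quotient.mkₐ ℂ P (x i)
  have hxi : AlgebraicIndependent ℂ x' := by
    rw [algebraicIndependent_iff]
    intro p hp
    have h1 : aeval x' p = Ideal.Quotient.mkₐ ℂ P (aeval x p) := by
      rw [← AlgHom.comp_apply, comp_aeval]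
    rw [h1] at hp
    have h2 : p ∈ P.comap (aeval x : MvPolynomial (Fin 4) ℂ →ₐ[ℂ] B).toRingHom := by
      have h3 : aeval x p ∈ P := Ideal.Quotient.eq_zero_iff_mem.1 hp
      exact h3
    rw [hPc] at h2
    exact h2
  obtain ⟨s, g, ginj, gint⟩ := exists_integral_inj_algHom_of_fg ℂ (B ⧸ P)
  let _ := g.toRingHom.toAlgebra
  have : IsScalarTower ℂ (MvPolynomial (Fin s) ℂ) (B ⧸ P) := IsScalarTower.of_algHom g
  have : Algebra.IsIntegral (MvPolynomial (Fin s) ℂ) (B ⧸ P) := ⟨gint⟩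
  have hd := (dim_le_of_int (R := MvPolynomial (Fin s) ℂ) (S := B ⧸ P) ginj).trans
    ((ringKrullDim_quotient_le P).trans hdim)
  rw [MvPolynomial.ringKrullDim_of_isNoetherianRing, ringKrullDim_eq_zero_of_field] at hd
  have hs : s ≤ 3 := by
    simp at hd
    exact_mod_cast hd
  have : FaithfulSMul (MvPolynomial (Fin s) ℂ) (B ⧸ P) := (faithfulSMul_iff_algebraMap_injective _ _).2 ginj
  have hb := (IsTranscendenceBasis.mvPolynomial (Fin s) ℂ).algebraMap_comp (A := B ⧸ P)
  have h1 := hb.cardinalMk_eq_trdeg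
  have h2 := hxi.cardinalMk_le_trdeg
  rw [← h1] at h2
  simp at h2
  norm_cast at h2
  omega

lemma exists_rel {n : ℕ} {I : Ideal (MvPolynomial (Fin n) ℂ)}
    (hdim : ringKrullDim (MvPolynomial (Fin n) ℂ ⧸ I) ≤ 3) (e : Fin 4 → Fin n) :
    ∃ p : MvPolynomial (Fin 4) ℂ, p ≠ 0 ∧ rename e p ∈ I := by
  have := not_indep hdim (fun i => Ideal.Quotient.mkₐ ℂ I (X (e i)))
  rw [algebraicIndependent_iff] at this
  push Not at this
  obtain ⟨p, hp, hp0⟩ := this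
  refine ⟨p, hp0, Ideal.Quotient.eq_zero_iff_mem.1 ?_⟩
  rw [← hp]
  change Ideal.Quotient.mkₐ ℂ I (rename e p) = _
  have h1 : (Ideal.Quotient.mkₐ ℂ I).comp (rename e) =
      aeval (fun i => Ideal.Quotient.mkₐ ℂ I (X (e i))) := by
    ext i; simp
  rw [← h1]; rfl

lemma reg3_iter {B : Type*} [CommRing B] [Algebra ℂ B] {p : MvPolynomial (Fin 4) ℂ} (hp : p ≠ 0)
    (z1 z2 : B) (a b c : MvPolynomial (Fin 4) B)
    (h : MvPolynomial.map (algebraMap ℂ B) p * a = C z1 * b + C z2 * c) :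
    ∃ b' c', a = C z1 * b' + C z2 * c' := by
  let J : Ideal B := Ideal.span {z1, z2}
  let mk := Ideal.Quotient.mk J
  let m : MonomialOrder (Fin 4) := MonomialOrder.lex
  have h1 : mk z1 = 0 := Ideal.Quotient.eq_zero_iff_mem.2 (Ideal.subset_span (by simp))
  have h2 : mk z2 = 0 := Ideal.Quotient.eq_zero_iff_mem.2 (Ideal.subset_span (by simp))
  have h3 := congrArg (MvPolynomial.map mk) h
  rw [map_mul, map_add, map_mul, map_mul, map_C, map_C, h1, h2, C_0, zero_mul, zero_mul, add_zero,
    map_map] at h3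
  have h4 := m.coeff_mul_of_add_of_degree_le (f := MvPolynomial.map (mk.comp (algebraMap ℂ B)) p)
    (g := MvPolynomial.map mk a) (a := m.degree p) (b := m.degree (MvPolynomial.map mk a))
    (by
      rw [MonomialOrder.degree_le_iff]
      intro e he
      exact m.le_degree (support_map_subset _ _ he)) le_rfl
  rw [h3, coeff_zero, coeff_map] at h4
  have h5 : IsUnit ((mk.comp (algebraMap ℂ B)) (coeff (m.degree p) p)) := by
    apply IsUnit.map
    rw [isUnit_iff_ne_zero]
    exact m.coeff_degree_ne_zero_iff.2 hp
  have h6 : coeff (m.degree (MvPolynomial.map mk a)) (MvPolynomial.map mk a) = 0 := by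
    rw [← h5.mul_right_eq_zero]; exact h4.symm
  have h7 : MvPolynomial.map mk a = 0 := by
    by_contra hne
    exact m.coeff_degree_ne_zero_iff.2 hne h6
  have h8 : a ∈ Ideal.map C J := by
    rw [MvPolynomial.mem_map_C_iff]
    intro e
    apply Ideal.Quotient.eq_zero_iff_mem.1
    change mk _ = 0
    rw [← coeff_map, h7, coeff_zero]
  rw [Ideal.map_span, Set.image_pair, Ideal.mem_span_pair] at h8
  obtain ⟨x, y, hxy⟩ := h8
  exact ⟨x, y, by rw [← hxy]; ring⟩

lemma reg2_iter {B : Type*} [CommRing B] [IsDomain B] [UniqueFactorizationMonoid B]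
    {z1 z2 : B} (hz : IsRelPrime z1 z2) (a b : MvPolynomial (Fin 4) B)
    (h : C z2 * a = C z1 * b) : ∃ c, a = C z1 * c := by
  change C z1 ∣ a
  rw [C_dvd_iff_dvd_coeff]
  intro e
  have := congrArg (coeff e) h
  rw [coeff_C_mul, coeff_C_mul] at this
  exact hz.dvd_of_dvd_mul_left ⟨_, this⟩

lemma mem_vars_deg {σ : Type*} {p : MvPolynomial σ ℂ} {v : σ} : v ∈ p.vars ↔ degreeOf v p ≠ 0 := by
  classical
  rw [vars_def, Multiset.mem_toFinset, degreeOf_def, Multiset.count_ne_zero]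

lemma exists_var {t : ℕ} {p : MvPolynomial (Fin t) ℂ} (hp : Prime p) : ∃ v, degreeOf v p ≠ 0 := by
  classical
  by_contra! hcon
  have h1 : p.vars = ∅ := by
    ext v
    rw [mem_vars_deg]
    simp [hcon v]
  rw [vars_eq_empty_iff_eq_C] at h1
  refine hp.not_isUnit ?_
  rw [h1]
  apply IsUnit.map
  rw [isUnit_iff_ne_zero]
  intro h2
  rw [h2, C_0] at h1
  exact hp.ne_zero h1

lemma exists_coprime {t : ℕ} (ht : 4 ≤ t) (J : Ideal (MvPolynomial (Fin (t+1)) ℂ))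
    (hJ : ∀ e : Fin 4 → Fin (t+1), ∃ p : MvPolynomial (Fin 4) ℂ, p ≠ 0 ∧ rename e p ∈ J) :
    ∃ z1 ∈ J, ∃ z2 ∈ J, z1 ≠ 0 ∧ IsRelPrime z1 z2 := by
  classical
  obtain ⟨p, hp0, hp⟩ := hJ (Fin.castLE (by omega))
  have hz1 : rename (Fin.castLE (show 4 ≤ t+1 by omega)) p ≠ 0 := by
    rwa [Ne, map_eq_zero_iff _ (rename_injective _ (Fin.castLE_injective _))]
  generalize rename (Fin.castLE (show 4 ≤ t+1 by omega)) p = z1 at *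
  let S := (UniqueFactorizationMonoid.factors z1).toFinset
  have hS : ∀ π ∈ S, Prime π := fun π hπ =>
    UniqueFactorizationMonoid.prime_of_factor π (Multiset.mem_toFinset.1 hπ)
  by_cases hsub : (J : Set (MvPolynomial (Fin (t+1)) ℂ)) ⊆ ⋃ π ∈ (S : Set (MvPolynomial (Fin (t+1)) ℂ)), (Ideal.span {π} : Ideal _)
  · exfalso
    obtain ⟨π, hπ, hle⟩ := (Ideal.subset_union_prime (f := fun π => Ideal.span {π}) 0 0 (fun π hπ _ _ =>
      (Ideal.span_singleton_prime (hS π hπ).ne_zero).2 (hS π hπ))).1 hsub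
    obtain ⟨v, hv⟩ := exists_var (hS π hπ)
    have hinj : Function.Injective (v.succAbove ∘ Fin.castLE ht) :=
      (Fin.succAbove_right_injective).comp (Fin.castLE_injective _)
    obtain ⟨p', hp0', hp'⟩ := hJ (v.succAbove ∘ Fin.castLE ht)
    obtain ⟨c, hc⟩ := Ideal.mem_span_singleton.1 (hle hp')
    have hw : rename (v.succAbove ∘ Fin.castLE ht) p' ≠ 0 := by
      rwa [Ne, map_eq_zero_iff _ (rename_injective _ hinj)]
    have hdeg : degreeOf v (rename (v.succAbove ∘ Fin.castLE ht) p') = 0 := by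
      by_contra hne
      have : v ∈ (rename (v.succAbove ∘ Fin.castLE ht) p').vars := mem_vars_deg.2 hne
      obtain ⟨i, _, hi⟩ := mem_vars_rename _ _ this
      exact Fin.succAbove_ne _ _ hi
    have hc0 : c ≠ 0 := by rintro rfl; exact hw (by rw [hc, mul_zero])
    rw [hc, degreeOf_mul_eq (hS π hπ).ne_zero hc0] at hdeg
    omega
  · rw [Set.not_subset] at hsub
    obtain ⟨z2, hz2, hn⟩ := hsub
    refine ⟨z1, hp, z2, hz2, hz1, ?_⟩
    apply WfDvdMonoid.isRelPrime_of_no_irreducible_factors (by tauto)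
    intro π hπ h1 h2
    obtain ⟨π', hπ', has⟩ := UniqueFactorizationMonoid.exists_mem_factors_of_dvd hz1 hπ h1
    apply hn
    simp only [Set.mem_iUnion]
    exact ⟨π', Multiset.mem_toFinset.2 hπ', Ideal.mem_span_singleton.2 (has.symm.dvd.trans h2)⟩

lemma exists_ys {n : ℕ} (hn : 8 ≤ n) (I : Ideal (MvPolynomial (Fin (n+1)) ℂ))
    (hdim : ringKrullDim (MvPolynomial (Fin (n+1)) ℂ ⧸ I) ≤ 3) :
    ∃ y1 ∈ I, ∃ y2 ∈ I, ∃ y3 ∈ I, y1 ≠ 0 ∧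
    (∀ a b, y2 * a = y1 * b → ∃ c, a = y1 * c) ∧
    (∀ a b c, y3 * a = y1 * b + y2 * c → ∃ b' c', a = y1 * b' + y2 * c') := by
  obtain ⟨t, rfl⟩ : ∃ t, n = t + 4 := ⟨n - 4, by omega⟩
  let e : Fin 4 ⊕ Fin (t+1) ≃ Fin (t+4+1) := finSumFinEquiv.trans (finCongr (by omega))
  let Θ : MvPolynomial (Fin (t+4+1)) ℂ ≃ₐ[ℂ] MvPolynomial (Fin 4) (MvPolynomial (Fin (t+1)) ℂ) :=
    (renameEquiv ℂ e.symm).trans (sumAlgEquiv ℂ _ _)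
  have hl : ∀ p : MvPolynomial (Fin 4) ℂ, Θ (rename (e ∘ Sum.inl) p) =
      MvPolynomial.map (algebraMap ℂ (MvPolynomial (Fin (t+1)) ℂ)) p := by
    intro p
    change sumAlgEquiv ℂ _ _ (rename e.symm (rename (e ∘ Sum.inl) p)) = _
    rw [rename_rename, show e.symm ∘ e ∘ Sum.inl = Sum.inl by ext1; simp]
    exact DFunLike.congr_fun (sumAlgEquiv_comp_rename_inl ..) p
  have hr : ∀ p : MvPolynomial (Fin (t+1)) ℂ, Θ (rename (e ∘ Sum.inr) p) = C p := by
    intro p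
    change sumAlgEquiv ℂ _ _ (rename e.symm (rename (e ∘ Sum.inr) p)) = _
    rw [rename_rename, show e.symm ∘ e ∘ Sum.inr = Sum.inr by ext1; simp]
    exact DFunLike.congr_fun (sumAlgEquiv_comp_rename_inr ..) p
  obtain ⟨z1, hz1, z2, hz2, h0, hcop⟩ := exists_coprime (t := t) (by omega)
    (I.comap (rename (e ∘ Sum.inr) : MvPolynomial (Fin (t+1)) ℂ →ₐ[ℂ] _)) (by
      intro f
      obtain ⟨p, hp0, hp⟩ := exists_rel hdim ((e ∘ Sum.inr) ∘ f)
      exact ⟨p, hp0, by rw [Ideal.mem_comap, rename_rename]; exact hp⟩)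
  obtain ⟨p, hp0, hp⟩ := exists_rel hdim (e ∘ Sum.inl)
  refine ⟨rename (e ∘ Sum.inr) z1, hz1, rename (e ∘ Sum.inr) z2, hz2,
    rename (e ∘ Sum.inl) p, hp, ?_, ?_, ?_⟩
  · rwa [Ne, map_eq_zero_iff _ (rename_injective _ (e.injective.comp Sum.inr_injective))]
  · intro a b hab
    have := congrArg Θ hab
    rw [map_mul, map_mul, hr, hr] at this
    obtain ⟨c, hc⟩ := reg2_iter hcop _ _ this
    refine ⟨Θ.symm c, Θ.injective ?_⟩
    rw [map_mul, AlgEquiv.apply_symm_apply, hc, hr]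
  · intro a b c hab
    have := congrArg Θ hab
    rw [map_mul, map_add, map_mul, map_mul, hr, hr, hl] at this
    obtain ⟨b', c', hc⟩ := reg3_iter hp0 _ _ _ _ _ this
    refine ⟨Θ.symm b', Θ.symm c', Θ.injective ?_⟩
    rw [map_add, map_mul, map_mul, AlgEquiv.apply_symm_apply, AlgEquiv.apply_symm_apply, hc, hr, hr]

/-- A totally invariant irreducible hypersurface of `ℙⁿ` (`n ≥ 10`) whose singular locus has
dimension at most `2` (Jacobian ring of Krull dimension `≤ 3`) is a hyperplane. -/
theorem two_dim_singularities_linear (n : ℕ) (hn : 10 ≤ n) (d : ℕ)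
    (h : MvPolynomial (Fin (n + 1)) ℂ) (hirr : Irreducible h) (hhom : h.IsHomogeneous d)
    (hdim : ringKrullDim (MvPolynomial (Fin (n + 1)) ℂ ⧸ jacobianIdeal (n + 1) h) ≤ 3)
    (hinv : IsTotallyInvariant (n + 1) h) :
    d = 1 := by
  obtain ⟨q, hq, F, hF, lam, hlam, hinv⟩ := hinv
  have hd0 : d ≠ 0 := by
    rintro rfl
    have h1 := homogeneousComponent_eq_self hhom
    rw [homogeneousComponent_zero] at h1
    have hne : coeff 0 h ≠ 0 := by
      intro h2
      rw [h2, C_0] at h1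
      exact hirr.ne_zero h1.symm
    refine hirr.not_isUnit ?_
    rw [← h1]
    exact (isUnit_iff_ne_zero.2 hne).map C
  by_contra hd1
  have hJ : jacobianIdeal (n + 1) h = Ideal.span (Set.range fun i => pderiv i h) := by
    apply le_antisymm
    · rw [jacobianIdeal, Ideal.span_le, Set.insert_subset_iff]
      refine ⟨?_, Ideal.subset_span⟩
      have h1 := hhom.sum_X_mul_pderiv
      have h2 : h = C ((d : ℂ)⁻¹) * ∑ i, X i * pderiv i h := by
        rw [h1, nsmul_eq_mul, ← mul_assoc, ← map_natCast C, ← C_mul,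
          inv_mul_cancel₀ (by exact_mod_cast hd0), C_1, one_mul]
      rw [h2]
      refine Ideal.mul_mem_left _ _ (Ideal.sum_mem _ fun i _ => Ideal.mul_mem_left _ _ ?_)
      rw [← h2]
      exact Ideal.subset_span ⟨i, rfl⟩
    · exact Ideal.span_mono (Set.subset_insert _ _)
  rw [hJ] at hdim
  obtain ⟨y1, hy1, y2, hy2, y3, hy3, h0, r2, r3⟩ := exists_ys (by omega) _ hdim
  obtain ⟨s, hs0, hs1, hs2⟩ := endo_free hF (by omega)
  exact step7 (s := s) ⟨hF, hq, hs0, hs1, hs2⟩ hinv (by omega) hhom y1 y2 y3 hy1 hy2 hy3 h0 r2 r3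
end
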